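/- arXiv:1903.05272 — 4 statements merged into one kernel-verified Lean document; each statement's English description precedes it below -/
import Mathlib

section
/- If s ∈ ℂ^n is typical, i.e. s_i + s_j ≠ 0 for all i ≠ j, then the ℂ-subalgebra of the Clifford algebra Cl(Q_s) generated by the elements φ_0(s), φ_1(s), …, φ_{n−1}(s) is the whole algebra Cl(Q_s). (Consequently every simple Cl(Q_s)-module V(s) remains simple when restricted to this subalgebra, which is the image of the W-algebra.) -/
open Matrix

noncomputable section

/-- For `s ∈ ℂⁿ`, the matrix `T(s)` with `T(s) i j = s j` for `i < j`, `-s j` for `i > j`,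
and `0` on the diagonal. -/
def Ts {n : ℕ} (s : Fin n → ℂ) : Matrix (Fin n) (Fin n) ℂ :=
  Matrix.of fun i j => if i < j then s j else if j < i then -s j else 0

/-- The quadratic form `Q_s` on `ℂⁿ` with `Q_s(eᵢ) = sᵢ` and polar form `B_s(eᵢ,eⱼ) = 0`
for `i ≠ j`. -/
def Qs {n : ℕ} (s : Fin n → ℂ) : QuadraticForm ℂ (Fin n → ℂ) :=
  QuadraticMap.weightedSumSquares ℂ s

/-- The elements `φ_k(s) = ι (T(s)^k v)` of the Clifford algebra `Cl(Q_s)`, where `v` is the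
all-ones vector. -/
def phi {n : ℕ} (s : Fin n → ℂ) (k : ℕ) : CliffordAlgebra (Qs s) :=
  CliffordAlgebra.ι (Qs s) ((Ts s ^ k).mulVec (fun _ => 1))

/-- A proper invariant subspace of an endomorphism over an algebraically closed field is
annihilated by an eigenvector of the dual endomorphism. -/
theorem exists_dual_eigenvector_of_invariant {K V : Type*} [Field K] [IsAlgClosed K]
    [AddCommGroup V] [Module K V] [FiniteDimensional K V] (T : Module.End K V)
    (W : Submodule K V) (hW : ∀ x ∈ W, T x ∈ W) (hne : W ≠ ⊤) :
    ∃ (f : Module.Dual K V) (c : K), f ≠ 0 ∧ (∀ x ∈ W, f x = 0) ∧ ∀ x, f (T x) = c * f x := by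
  obtain ⟨f, hf, hfW⟩ := Submodule.exists_le_ker_of_lt_top W (lt_top_iff_ne_top.mpr hne)
  have hmaps : ∀ g ∈ W.dualAnnihilator, T.dualMap g ∈ W.dualAnnihilator := by
    intro g hg
    rw [Submodule.mem_dualAnnihilator] at hg ⊢
    exact fun x hx => hg _ (hW x hx)
  have hf' : f ∈ W.dualAnnihilator := by
    rw [Submodule.mem_dualAnnihilator]
    exact fun x hx => hfW hx
  have : Nontrivial W.dualAnnihilator :=
    ⟨⟨⟨f, hf'⟩, 0, fun h => hf (congrArg Subtype.val h)⟩⟩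
  obtain ⟨c, hc⟩ := Module.End.exists_eigenvalue (K := K) (V := W.dualAnnihilator)
    (T.dualMap.restrict hmaps)
  obtain ⟨g, hg⟩ := hc.exists_hasEigenvector
  refine ⟨g.1, c, fun h => hg.2 (Subtype.ext h),
    (Submodule.mem_dualAnnihilator _).mp g.2, fun x => ?_⟩
  exact LinearMap.congr_fun (congrArg Subtype.val hg.apply_eq_smul) x

/-- For typical `s`, no nonzero left eigenvector of `T(s)` is orthogonal to the all-ones
vector. -/
theorem left_eigenvector_Ts_eq_zero {n : ℕ} (s : Fin n → ℂ)
    (htyp : ∀ i j : Fin n, i ≠ j → s i + s j ≠ 0) (w : Fin n → ℂ) (c : ℂ)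
    (hw : ∀ j, ∑ i, w i * Ts s i j = c * w j) (hsum : ∑ i, w i = 0) : w = 0 := by
  set P : ℕ → ℂ := fun m => ∑ i, if i.val < m then w i else 0 with hP
  have hP0 : P 0 = 0 := by simp [hP]
  have hPn : P n = 0 := by simp [hP, hsum]
  have hsucc : ∀ j : Fin n, P (j + 1) = P j + w j := by
    intro j
    have : w j = ∑ i, if i = j then w i else 0 := by simp
    rw [this, hP]
    simp only [← Finset.sum_add_distrib]
    refine Finset.sum_congr rfl fun i _ => ?_
    rcases lt_trichotomy i j with h | h | h
    · have : i.val < j.val := h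
      simp [h.ne, this, Nat.lt_succ_of_lt this]
    · simp [h]
    · have : j.val < i.val := h
      simp [h.ne', this.not_gt, show ¬ i.val < j.val + 1 by omega]
  have hcol : ∀ j : Fin n, ∑ i, w i * Ts s i j = s j * (P j + P (j + 1)) := by
    intro j
    have : s j * (P j + P (j + 1)) = s j * (P j + P (j + 1)) - s j * ∑ i, w i := by
      rw [hsum]; ring
    rw [this, hP]
    simp only [Finset.mul_sum, ← Finset.sum_add_distrib, ← Finset.sum_sub_distrib]
    refine Finset.sum_congr rfl fun i _ => ?_
    rcases lt_trichotomy i j with h | h | h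
    · have : i.val < j.val := h
      simp [Ts, h, this, Nat.lt_succ_of_lt this]
      ring
    · simp [Ts, h]
    · have : j.val < i.val := h
      simp [Ts, h, h.not_gt, show ¬ i.val < j.val + 1 by omega]
      ring
  have hrec : ∀ j : Fin n, (s j - c) * P (j + 1) = -((s j + c) * P j) := by
    intro j
    linear_combination hw j - hcol j - c * hsucc j
  have hzero : ∀ m ≤ n, P m = 0 := by
    by_contra! hex
    classical
    obtain ⟨hmn, hm⟩ := Nat.find_spec hex
    set m := Nat.find hex
    obtain ⟨a, ha⟩ : ∃ a, m = a + 1 :=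
      Nat.exists_eq_succ_of_ne_zero fun h => hm (by rw [h, hP0])
    have hPa : P a = 0 := by
      by_contra h
      exact Nat.find_min hex (m := a) (by omega) ⟨by omega, h⟩
    have han : a < n := by omega
    have hc : s ⟨a, han⟩ = c := by
      have h := hrec ⟨a, han⟩
      simp only [hPa, mul_zero, neg_zero, ← ha] at h
      exact sub_eq_zero.mp ((mul_eq_zero.mp h).resolve_right hm)
    have hlast : ∀ b, m ≤ b → b ≤ n → P b ≠ 0 := by
      intro b hb
      induction b, hb using Nat.le_induction with
      | base => exact fun _ => hm
      | succ b hb ih =>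
        intro hbn h0
        have h := hrec ⟨b, hbn⟩
        simp only [h0, mul_zero] at h
        have hne : s ⟨b, hbn⟩ + c ≠ 0 := by
          rw [← hc]
          exact htyp _ _ fun h => by simp only [Fin.mk.injEq] at h; omega
        exact mul_ne_zero hne (ih (by omega)) (neg_eq_zero.mp h.symm)
    exact hlast n hmn le_rfl hPn
  funext j
  have h := hsucc j
  rw [hzero _ j.isLt, hzero _ j.isLt.le, zero_add] at h
  exact h.symm

/-- The powers `M ^ k`, `k < n`, of an `n × n` matrix applied to a vector span an invariant
subspace. -/
theorem mulVec_mem_span_pow_mulVec {K : Type*} [Field K] {n : ℕ}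
    (M : Matrix (Fin n) (Fin n) K) (v x : Fin n → K)
    (hx : x ∈ Submodule.span K {y | ∃ k < n, y = (M ^ k).mulVec v}) :
    M.mulVec x ∈ Submodule.span K {y | ∃ k < n, y = (M ^ k).mulVec v} := by
  have hpow : ∀ k, (M ^ k).mulVec v ∈ Submodule.span K {y | ∃ k < n, y = (M ^ k).mulVec v} := by
    intro k
    rcases Nat.eq_zero_or_pos n with rfl | hn
    · rw [Subsingleton.elim ((M ^ k).mulVec v) 0]
      exact zero_mem _
    have hdeg : ((Polynomial.X : Polynomial K) ^ k %ₘ M.charpoly).natDegree < n := by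
      have h := Polynomial.natDegree_modByMonic_lt (Polynomial.X ^ k) M.charpoly_monic
        (fun h => by
          have := M.charpoly_natDegree_eq_dim
          rw [h, Polynomial.natDegree_one, Fintype.card_fin] at this
          omega)
      rwa [M.charpoly_natDegree_eq_dim, Fintype.card_fin] at h
    rw [M.pow_eq_aeval_mod_charpoly, Polynomial.aeval_eq_sum_range' hdeg, Matrix.sum_mulVec]
    refine Submodule.sum_mem _ fun i hi => ?_
    rw [Matrix.smul_mulVec]
    exact Submodule.smul_mem _ _ (Submodule.subset_span ⟨i, Finset.mem_range.mp hi, rfl⟩)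
  induction hx using Submodule.span_induction with
  | mem y hy =>
    obtain ⟨k, -, rfl⟩ := hy
    rw [Matrix.mulVec_mulVec, ← pow_succ']
    exact hpow _
  | zero => simp
  | add y z _ _ hy hz => rw [Matrix.mulVec_add]; exact add_mem hy hz
  | smul c y _ hy => rw [Matrix.mulVec_smul]; exact Submodule.smul_mem _ _ hy

/-- For typical `s`, the all-ones vector is a cyclic vector of `T(s)`. -/
theorem span_Ts_pow_mulVec_eq_top {n : ℕ} (hn : 0 < n) (s : Fin n → ℂ)
    (htyp : ∀ i j : Fin n, i ≠ j → s i + s j ≠ 0) :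
    Submodule.span ℂ {y | ∃ k < n, y = (Ts s ^ k).mulVec (fun _ => 1)} = ⊤ := by
  by_contra hne
  obtain ⟨f, c, hf, hfW, hfT⟩ := exists_dual_eigenvector_of_invariant (Ts s).mulVecLin _
    (mulVec_mem_span_pow_mulVec (Ts s) fun _ => 1) hne
  have hsum (x : Fin n → ℂ) : f x = ∑ i, f (Pi.single i 1) * x i := by
    rw [LinearMap.pi_apply_eq_sum_univ f x]
    refine Finset.sum_congr rfl fun i _ => ?_
    rw [smul_eq_mul, mul_comm]
    congr 2
    ext j
    simp [Pi.single_apply, eq_comm]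
  have hw : (fun i => f (Pi.single i 1)) = 0 := by
    refine left_eigenvector_Ts_eq_zero s htyp _ c (fun j => ?_) ?_
    · rw [← hfT, hsum ((Ts s).mulVecLin _)]
      simp
    · have h := hfW (fun _ => 1) (Submodule.subset_span ⟨0, hn, by simp⟩)
      rw [hsum] at h
      simpa using h
  refine hf (LinearMap.ext fun x => ?_)
  rw [hsum]
  exact Finset.sum_eq_zero fun i _ => by rw [show f (Pi.single i 1) = 0 from congrFun hw i, zero_mul]

theorem typical_phi_generate {n : ℕ} (hn : 0 < n) (s : Fin n → ℂ)
    (htyp : ∀ i j : Fin n, i ≠ j → s i + s j ≠ 0) :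
    Algebra.adjoin ℂ {x : CliffordAlgebra (Qs s) | ∃ k : ℕ, k < n ∧ x = phi s k} = ⊤ := by
  rw [eq_top_iff, ← CliffordAlgebra.adjoin_range_ι]
  refine Algebra.adjoin_le ?_
  rintro _ ⟨x, rfl⟩
  have hx : x ∈ Submodule.span ℂ {y | ∃ k < n, y = (Ts s ^ k).mulVec (fun _ => 1)} := by
    rw [span_Ts_pow_mulVec_eq_top hn s htyp]
    trivial
  induction hx using Submodule.span_induction with
  | mem y hy =>
    obtain ⟨k, hk, rfl⟩ := hy
    exact Algebra.subset_adjoin ⟨k, hk, rfl⟩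
  | zero => rw [map_zero]; exact zero_mem _
  | add y z _ _ hy hz => rw [map_add]; exact add_mem hy hz
  | smul c y _ hy => rw [map_smul]; exact Subalgebra.smul_mem _ hy c
end
end

section
/- Let s ∈ ℂ^n be typical (s_i + s_j ≠ 0 for all i ≠ j) and let s' be obtained from s by a permutation of its coordinates. Then there exists a ℂ-algebra isomorphism F : Cl(Q_s) → Cl(Q_{s'}) such that F(φ_k(s)) = φ_k(s') for every k = 0, 1, …, n−1. (This realizes the isomorphism of W-modules V(s) ≅ V(s').) -/
open Matrix

noncomputable section

/-- The sign of `j - k` on a linear order. -/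
def orderSign {n : ℕ} (k j : Fin n) : ℂ := if k < j then 1 else if j < k then -1 else 0

lemma Ts_mulVec_apply {n : ℕ} (s x : Fin n → ℂ) (k : Fin n) :
    (Ts s *ᵥ x) k = ∑ j, orderSign k j * (s j * x j) := by
  simp only [Matrix.mulVec, dotProduct, Ts, Matrix.of_apply, orderSign]
  refine Finset.sum_congr rfl fun j _ => ?_
  split_ifs <;> ring

/-- The transvection `x ↦ x + (s_p - s_q) / (s_p + s_q) • (x_p - x_q) • (e_p + e_q)`. -/
def swapEquiv {n : ℕ} (s : Fin n → ℂ) {p q : Fin n} (hpq : p ≠ q) :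
    (Fin n → ℂ) ≃ₗ[ℂ] (Fin n → ℂ) :=
  LinearEquiv.transvection
    (f := ((s p - s q) / (s p + s q)) •
      ((LinearMap.proj p : (Fin n → ℂ) →ₗ[ℂ] ℂ) - (LinearMap.proj q : (Fin n → ℂ) →ₗ[ℂ] ℂ)))
    (v := Pi.single p 1 + Pi.single q 1) (by simp [hpq, hpq.symm])

lemma swapEquiv_apply {n : ℕ} (s : Fin n → ℂ) {p q : Fin n} (hpq : p ≠ q) (x : Fin n → ℂ)
    (k : Fin n) :
    swapEquiv s hpq x k = x k + (s p - s q) / (s p + s q) * (x p - x q) *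
      ((if k = p then 1 else 0) + if k = q then 1 else 0) := by
  simp [swapEquiv, LinearMap.transvection.apply, Pi.single_apply, mul_add]

lemma swapEquiv_one {n : ℕ} (s : Fin n → ℂ) {p q : Fin n} (hpq : p ≠ q) :
    swapEquiv s hpq (fun _ => 1) = fun _ => 1 := by
  ext k
  simp [swapEquiv_apply]

lemma Qs_swapEquiv {n : ℕ} (s : Fin n → ℂ) {p q : Fin n} (hpq : p ≠ q) (h : s p + s q ≠ 0)
    (x : Fin n → ℂ) :
    Qs (s ∘ Equiv.swap p q) (swapEquiv s hpq x) = Qs s x := by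
  simp only [Qs, QuadraticMap.weightedSumSquares_apply, smul_eq_mul]
  rw [← sub_eq_zero, ← Finset.sum_sub_distrib, Fintype.sum_eq_add p q hpq]
  · simp only [swapEquiv_apply, Function.comp_apply, Equiv.swap_apply_left,
      Equiv.swap_apply_right, hpq, hpq.symm, if_true, if_false]
    field_simp
    ring
  · rintro k ⟨hp, hq⟩
    simp [swapEquiv_apply, hp, hq, Equiv.swap_apply_of_ne_of_ne hp hq]

lemma swapEquiv_Ts_mulVec {n : ℕ} (s : Fin n → ℂ) {p q : Fin n} (hpq : (p : ℕ) + 1 = q)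
    (hne : p ≠ q) (h : s p + s q ≠ 0) (x : Fin n → ℂ) :
    swapEquiv s hne (Ts s *ᵥ x) = Ts (s ∘ Equiv.swap p q) *ᵥ swapEquiv s hne x := by
  have hlt : p < q := by rw [Fin.lt_def]; omega
  have hdiff : (Ts s *ᵥ x) p - (Ts s *ᵥ x) q = s p * x p + s q * x q := by
    simp only [Ts_mulVec_apply]
    rw [← Finset.sum_sub_distrib, Fintype.sum_eq_add p q hne]
    · simp [orderSign, hlt, hlt.not_gt]
    · rintro k ⟨hp, hq⟩
      have : orderSign p k = orderSign q k := by
        unfold orderSign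
        split_ifs <;> first | rfl | (exfalso; grind)
      simp [this]
  ext k
  rw [swapEquiv_apply, hdiff, ← eq_sub_iff_add_eq', Ts_mulVec_apply, Ts_mulVec_apply,
    ← Finset.sum_sub_distrib, Fintype.sum_eq_add p q hne]
  · simp only [swapEquiv_apply, Function.comp_apply, Equiv.swap_apply_left,
      Equiv.swap_apply_right, hne, hne.symm, if_true, if_false]
    by_cases hp : k = p
    · subst hp
      simp only [orderSign, hlt, lt_irrefl, hne, if_true, if_false]
      field_simp
      ring
    by_cases hq : k = q
    · subst hq
      simp only [orderSign, hlt, hlt.not_gt, lt_irrefl, hne.symm, if_true, if_false]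
      field_simp
      ring
    have : orderSign k p = orderSign k q := by
      unfold orderSign
      split_ifs <;> first | rfl | (exfalso; grind)
    simp only [this, hp, hq, if_false]
    field_simp
    ring
  · rintro j ⟨hp, hq⟩
    simp [swapEquiv_apply, hp, hq, Equiv.swap_apply_of_ne_of_ne hp hq]

lemma swapEquiv_Ts_pow_mulVec {n : ℕ} (s : Fin n → ℂ) {p q : Fin n} (hpq : (p : ℕ) + 1 = q)
    (hne : p ≠ q) (h : s p + s q ≠ 0) (k : ℕ) :
    swapEquiv s hne ((Ts s ^ k) *ᵥ fun _ => 1) =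
      (Ts (s ∘ Equiv.swap p q) ^ k) *ᵥ fun _ => 1 := by
  induction k with
  | zero => simp [swapEquiv_one]
  | succ k ih =>
    rw [pow_succ', pow_succ', ← Matrix.mulVec_mulVec, ← Matrix.mulVec_mulVec,
      swapEquiv_Ts_mulVec s hpq hne h, ih]

lemma exists_algEquiv_swap {n : ℕ} (s : Fin n → ℂ) {p q : Fin n} (hpq : (p : ℕ) + 1 = q)
    (h : s p + s q ≠ 0) :
    ∃ F : CliffordAlgebra (Qs s) ≃ₐ[ℂ] CliffordAlgebra (Qs (s ∘ Equiv.swap p q)),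
      ∀ k : ℕ, F (phi s k) = phi (s ∘ Equiv.swap p q) k := by
  have hne : p ≠ q := by rintro rfl; omega
  refine ⟨CliffordAlgebra.equivOfIsometry
    { swapEquiv s hne with map_app' := Qs_swapEquiv s hne h }, fun k => ?_⟩
  rw [phi, phi, ← swapEquiv_Ts_pow_mulVec s hpq hne h]
  exact CliffordAlgebra.map_apply_ι _ _

lemma exists_algEquiv_perm {m : ℕ} (σ : Equiv.Perm (Fin (m + 1))) (s : Fin (m + 1) → ℂ)
    (htyp : ∀ i j, i ≠ j → s i + s j ≠ 0) :
    ∃ F : CliffordAlgebra (Qs s) ≃ₐ[ℂ] CliffordAlgebra (Qs (s ∘ σ)),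
      ∀ k : ℕ, F (phi s k) = phi (s ∘ σ) k := by
  have hσ : σ ∈ Submonoid.closure
      (Set.range fun i : Fin m => Equiv.swap i.castSucc i.succ) := by
    rw [Equiv.Perm.mclosure_swap_castSucc_succ]
    trivial
  induction hσ using Submonoid.closure_induction generalizing s with
  | mem τ hτ =>
    obtain ⟨i, rfl⟩ := hτ
    exact exists_algEquiv_swap s (by simp) (htyp _ _ i.castSucc_lt_succ.ne)
  | one => exact ⟨AlgEquiv.refl, fun k => rfl⟩
  | mul τ ρ _ _ hτ hρ =>
    obtain ⟨F, hF⟩ := hτ s htyp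
    obtain ⟨G, hG⟩ := hρ (s ∘ τ) fun i j hij => htyp _ _ (τ.injective.ne hij)
    exact ⟨F.trans G, fun k => (congrArg G (hF k)).trans (hG k)⟩

theorem permutation_isomorphism {n : ℕ} (hn : 0 < n) (s : Fin n → ℂ)
    (htyp : ∀ i j : Fin n, i ≠ j → s i + s j ≠ 0) (σ : Equiv.Perm (Fin n)) :
    ∃ F : CliffordAlgebra (Qs s) ≃ₐ[ℂ] CliffordAlgebra (Qs (s ∘ σ)),
      ∀ k : ℕ, k < n → F (phi s k) = phi (s ∘ σ) k := by
  obtain ⟨m, rfl⟩ := Nat.exists_eq_succ_of_ne_zero hn.ne'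
  obtain ⟨F, hF⟩ := exists_algEquiv_perm σ s htyp
  exact ⟨F, fun k _ => hF k⟩
end
end

section
/- Define z_k ∈ Cl(Q) for k = 0, 1, …, n−1 as follows: for even k, z_k := ζ_k · 1 (the scalar ζ_k = v^t C T^k v viewed in Cl(Q)); for odd k, z_k is the even component, with respect to the ℤ/2ℤ-grading of Cl(Q), of Σ_{1≤i_1<⋯<i_{k+1}≤n} (x_{i_1} + (−1)^{k} ξ_{i_1}) ⋯ (x_{i_k} − ξ_{i_k})(x_{i_{k+1}} + ξ_{i_{k+1}}) (the t-th factor carries sign (−1)^{k+1−t} in front of ξ_{i_t}). Then the elements z_0, …, z_{n−1} pairwise commute and are algebraically independent over ℂ; that is, the subalgebra W_0 of Cl(Q) they generate is isomorphic to the polynomial algebra ℂ[z_0,…,z_{n−1}]. -/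
open MvPolynomial Matrix

noncomputable section

/-- The matrix `T` over `ℂ[x₁,…,xₙ]` with `T i j = x j` for `i < j`, `-x j` for `i > j`,
and `0` on the diagonal. -/
def Tmat (n : ℕ) : Matrix (Fin n) (Fin n) (MvPolynomial (Fin n) ℂ) :=
  Matrix.of fun i j => if i < j then X j else if j < i then -X j else 0

/-- The polynomial `ζ_m = vᵗ · C · T^m · v`, where `v` is the all-ones vector and
`C = diag (x₁,…,xₙ)`. -/
def zeta (n m : ℕ) : MvPolynomial (Fin n) ℂ :=
  dotProduct (fun _ => 1)
    ((Matrix.diagonal fun i : Fin n => (X i : MvPolynomial (Fin n) ℂ)).mulVec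
      ((Tmat n ^ m).mulVec (fun _ => 1)))

/-- The quadratic form `Q` on the free module `R^n` (with `R = ℂ[x₁,…,xₙ]`) satisfying
`Q(eᵢ) = xᵢ` and whose polar form satisfies `B(eᵢ, eⱼ) = 0` for `i ≠ j`; thus in `Cl(Q)`
the elements `ξᵢ = ι(eᵢ)` satisfy `ξᵢ² = xᵢ` and `ξᵢξⱼ = -ξⱼξᵢ` for `i ≠ j`. -/
def Qform (n : ℕ) : QuadraticForm (MvPolynomial (Fin n) ℂ) (Fin n → MvPolynomial (Fin n) ℂ) :=
  QuadraticMap.weightedSumSquares (MvPolynomial (Fin n) ℂ)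
    (fun i : Fin n => (X i : MvPolynomial (Fin n) ℂ))

/-- For a subset `s = {i₁ < i₂ < ⋯}` of indices of size `m`, the ordered product whose
`t`-th factor from the left (`t` zero-based) is `x_{i_t} + (−1)^{m−1−t} ξ_{i_t}`. -/
def cliffFactors (n m : ℕ) (s : Finset (Fin n)) : CliffordAlgebra (Qform n) :=
  ((s.sort (· ≤ ·)).mapIdx fun t i =>
    algebraMap (MvPolynomial (Fin n) ℂ) (CliffordAlgebra (Qform n)) (X i) +
      ((-1 : MvPolynomial (Fin n) ℂ) ^ (m - 1 - t)) •
        CliffordAlgebra.ι (Qform n) (Pi.single i 1)).prod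

/-- The element `z_k` of `Cl(Q)`: for even `k` the scalar `ζ_k`; for odd `k` the even
component, in the `ℤ/2ℤ`-grading, of
`Σ_{1 ≤ i₁ < ⋯ < i_{k+1} ≤ n} (x_{i₁} + (−1)^k ξ_{i₁}) ⋯ (x_{i_k} − ξ_{i_k})(x_{i_{k+1}} + ξ_{i_{k+1}})`. -/
def zel (n k : ℕ) : CliffordAlgebra (Qform n) :=
  if Even k then
    algebraMap (MvPolynomial (Fin n) ℂ) (CliffordAlgebra (Qform n)) (zeta n k)
  else
    (DirectSum.decompose (CliffordAlgebra.evenOdd (Qform n))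
        (∑ s ∈ Finset.univ.powersetCard (k + 1), cliffFactors n (k + 1) s) (0 : ZMod 2) :
      CliffordAlgebra (Qform n))

/-- The quadratic exchange relations between the four components of the transfer matrix at the
spectral parameters `l` and `m`. Here `p, r` are even, `q, s` are odd, and `p, q` (resp. `r, s`)
collect the even (resp. odd) powers of the spectral parameter. -/
structure ExchangeRel {K A : Type*} [CommRing K] [Ring A] [Algebra K A] (l m : K)
    (p₁ q₁ r₁ s₁ p₂ q₂ r₂ s₂ : A) : Prop where
  pp : p₁ * p₂ - p₂ * p₁ = 0
  rr : r₁ * r₂ - r₂ * r₁ = 0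
  pr_sub_ss : m • (p₁ * r₂ - r₂ * p₁) + l • (r₁ * p₂ - p₂ * r₁) -
    (l * m) • (s₁ * s₂ - s₂ * s₁) = 0
  pr_sub_qq : l • (p₁ * r₂ - r₂ * p₁) + m • (r₁ * p₂ - p₂ * r₁) -
    (l * m) • (q₁ * q₂ - q₂ * q₁) = 0
  pr_add_qs : l • (p₁ * r₂ - r₂ * p₁) + l • (q₁ * s₂ + s₂ * q₁) + m • (r₁ * p₂ - p₂ * r₁) -
    m • (s₁ * q₂ + q₂ * s₁) = 0
  pr_sub_qs : m • (p₁ * r₂ - r₂ * p₁) - m • (q₁ * s₂ + s₂ * q₁) + l • (r₁ * p₂ - p₂ * r₁) +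
    l • (s₁ * q₂ + q₂ * s₁) = 0
  ss : (l * m ^ 2) • (p₁ * r₂ + r₂ * p₁) + (l * m ^ 2) • (q₁ * s₂ - s₂ * q₁) -
    (l ^ 2 * m) • (r₁ * p₂ + p₂ * r₁) + (l ^ 2 * m) • (s₁ * q₂ - q₂ * s₁) +
    (l ^ 2 - m ^ 2) • (s₁ * s₂ + s₂ * s₁) = 0
  qq : (l ^ 2 * m) • (p₁ * r₂ + r₂ * p₁) - (l ^ 2 * m) • (q₁ * s₂ - s₂ * q₁) -
    (l * m ^ 2) • (r₁ * p₂ + p₂ * r₁) - (l * m ^ 2) • (s₁ * q₂ - q₂ * s₁) +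
    (m ^ 2 - l ^ 2) • (q₁ * q₂ + q₂ * q₁) = 0
  ps : m • (p₁ * s₂ - s₂ * p₁) + l • (s₁ * p₂ - p₂ * s₁) = 0
  rs : r₁ * s₂ - s₂ * r₁ + (s₁ * r₂ - r₂ * s₁) = 0
  pq : p₁ * q₂ - q₂ * p₁ + (q₁ * p₂ - p₂ * q₁) = 0
  qr : l • (q₁ * r₂ - r₂ * q₁) + m • (r₁ * q₂ - q₂ * r₁) = 0
  pq_ps : (m ^ 2 - l ^ 2) • (p₁ * q₂ - q₂ * p₁) - (l ^ 2 * m) • (p₁ * s₂ + s₂ * p₁) +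
    (l * m ^ 2) • (s₁ * p₂ + p₂ * s₁) = 0
  ps_pq : l • (p₁ * s₂ - s₂ * p₁) + m • (s₁ * p₂ - p₂ * s₁) +
    (l * m) • (p₁ * q₂ + q₂ * p₁) - (l * m) • (q₁ * p₂ + p₂ * q₁) = 0
  rs_qr : (m ^ 2 - l ^ 2) • (r₁ * s₂ - s₂ * r₁) + (l * m ^ 2) • (q₁ * r₂ + r₂ * q₁) -
    (l ^ 2 * m) • (r₁ * q₂ + q₂ * r₁) = 0
  qr_rs : m • (q₁ * r₂ - r₂ * q₁) + l • (r₁ * q₂ - q₂ * r₁) +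
    (l * m) • (r₁ * s₂ + s₂ * r₁) - (l * m) • (s₁ * r₂ + r₂ * s₁) = 0

section TransferStep

variable {K A : Type*} [CommRing K] [Ring A] [Algebra K A] {x : K} {ξ : A}

lemma transfer_mul_of_commute (l m : K) (hξ : ξ * ξ = x • 1) {a b c a' b' c' : A}
    (ha : a * ξ = ξ * a) (hb : b * ξ = ξ * b) (hc : c * ξ = -(ξ * c)) :
    (a + l • (x • b + ξ * c)) * (a' + m • (x • b' + ξ * c')) =
      a * a' + (m * x) • (a * b') + (l * x) • (b * a') + (l * m * x ^ 2) • (b * b') -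
      (l * m * x) • (c * c') + ξ * (m • (a * c') + l • (c * a') +
        (l * m * x) • (b * c') + (l * m * x) • (c * b')) := by
  have h₁ : a * (ξ * c') = ξ * (a * c') := by rw [← mul_assoc, ha, mul_assoc]
  have h₂ : b * (ξ * c') = ξ * (b * c') := by rw [← mul_assoc, hb, mul_assoc]
  have h₃ : ξ * (c * (ξ * c')) = -(x • (c * c')) := by
    rw [← mul_assoc c, hc, neg_mul, mul_neg, ← mul_assoc, ← mul_assoc, hξ, smul_one_mul,
      smul_mul_assoc]
  simp only [mul_add, add_mul, smul_mul_assoc, mul_smul_comm, h₁, h₂, mul_assoc, smul_add, h₃]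
  module

lemma transfer_mul_of_anticommute (l m : K) (hξ : ξ * ξ = x • 1) {a b c a' b' c' : A}
    (ha : a * ξ = -(ξ * a)) (hb : b * ξ = -(ξ * b)) (hc : c * ξ = ξ * c) :
    (a + l • (x • b + ξ * c)) * (a' + m • (x • b' + ξ * c')) =
      a * a' + (m * x) • (a * b') + (l * x) • (b * a') + (l * m * x ^ 2) • (b * b') +
      (l * m * x) • (c * c') + ξ * (-(m • (a * c')) + l • (c * a') -
        (l * m * x) • (b * c') + (l * m * x) • (c * b')) := by
  have h₁ : a * (ξ * c') = -(ξ * (a * c')) := by rw [← mul_assoc, ha, neg_mul, mul_assoc]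
  have h₂ : b * (ξ * c') = -(ξ * (b * c')) := by rw [← mul_assoc, hb, neg_mul, mul_assoc]
  have h₃ : ξ * (c * (ξ * c')) = x • (c * c') := by
    rw [← mul_assoc c, hc, ← mul_assoc, ← mul_assoc, hξ, smul_one_mul, smul_mul_assoc]
  simp only [mul_add, add_mul, smul_mul_assoc, mul_smul_comm, h₁, h₂, mul_assoc, smul_add, h₃,
    mul_sub, mul_neg]
  module

set_option maxHeartbeats 1000000 in
/-- The exchange relations are preserved when a site `(x, ξ)` is added. -/
theorem ExchangeRel.step {l m : K} (hξ : ξ * ξ = x • 1) {p₁ q₁ r₁ s₁ p₂ q₂ r₂ s₂ : A}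
    (hp₁ : p₁ * ξ = ξ * p₁) (hq₁ : q₁ * ξ = -(ξ * q₁))
    (hr₁ : r₁ * ξ = ξ * r₁) (hs₁ : s₁ * ξ = -(ξ * s₁))
    (hp₂ : p₂ * ξ = ξ * p₂) (hq₂ : q₂ * ξ = -(ξ * q₂))
    (hr₂ : r₂ * ξ = ξ * r₂) (hs₂ : s₂ * ξ = -(ξ * s₂))
    (h : ExchangeRel l m p₁ q₁ r₁ s₁ p₂ q₂ r₂ s₂) :
    ExchangeRel l m
      (p₁ + l • (x • r₁ + ξ * -s₁)) (q₁ + l • (x • s₁ + ξ * -r₁))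
      (r₁ + l • (x • p₁ + ξ * q₁)) (s₁ + l • (x • q₁ + ξ * p₁))
      (p₂ + m • (x • r₂ + ξ * -s₂)) (q₂ + m • (x • s₂ + ξ * -r₂))
      (r₂ + m • (x • p₂ + ξ * q₂)) (s₂ + m • (x • q₂ + ξ * p₂)) := by
  have hns₁ : -s₁ * ξ = -(ξ * -s₁) := by rw [neg_mul, hs₁, mul_neg]
  have hns₂ : -s₂ * ξ = -(ξ * -s₂) := by rw [neg_mul, hs₂, mul_neg]
  have hnr₁ : -r₁ * ξ = ξ * -r₁ := by rw [neg_mul, hr₁, mul_neg]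
  have hnr₂ : -r₂ * ξ = ξ * -r₂ := by rw [neg_mul, hr₂, mul_neg]
  have left_zero {w : A} (hw : w = 0) : ξ * w = 0 := by rw [hw, mul_zero]
  have k_pp := left_zero h.pp
  have k_rr := left_zero h.rr
  have k_pr_sub_ss := left_zero h.pr_sub_ss
  have k_pr_sub_qq := left_zero h.pr_sub_qq
  have k_pr_add_qs := left_zero h.pr_add_qs
  have k_pr_sub_qs := left_zero h.pr_sub_qs
  have k_ss := left_zero h.ss
  have k_qq := left_zero h.qq
  have k_ps := left_zero h.ps
  have k_rs := left_zero h.rs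
  have k_pq := left_zero h.pq
  have k_qr := left_zero h.qr
  have k_pq_ps := left_zero h.pq_ps
  have k_ps_pq := left_zero h.ps_pq
  have k_rs_qr := left_zero h.rs_qr
  have k_qr_rs := left_zero h.qr_rs
  simp only [mul_add, mul_sub, mul_smul_comm] at k_pp k_rr k_pr_sub_ss k_pr_sub_qq k_pr_add_qs
  simp only [mul_add, mul_sub, mul_smul_comm] at k_pr_sub_qs k_ss k_qq
  simp only [mul_add, mul_sub, mul_smul_comm] at k_ps k_rs k_pq k_qr k_pq_ps k_ps_pq k_rs_qr k_qr_rs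
  have mul_p₁ {a b c : A} := transfer_mul_of_commute l m hξ (a' := a) (b' := b) (c' := c)
    hp₁ hr₁ hns₁
  have mul_q₁ {a b c : A} := transfer_mul_of_anticommute l m hξ (a' := a) (b' := b) (c' := c)
    hq₁ hs₁ hnr₁
  have mul_r₁ {a b c : A} := transfer_mul_of_commute l m hξ (a' := a) (b' := b) (c' := c)
    hr₁ hp₁ hq₁
  have mul_s₁ {a b c : A} := transfer_mul_of_anticommute l m hξ (a' := a) (b' := b) (c' := c)
    hs₁ hq₁ hp₁
  have mul_p₂ {a b c : A} := transfer_mul_of_commute m l hξ (a' := a) (b' := b) (c' := c)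
    hp₂ hr₂ hns₂
  have mul_q₂ {a b c : A} := transfer_mul_of_anticommute m l hξ (a' := a) (b' := b) (c' := c)
    hq₂ hs₂ hnr₂
  have mul_r₂ {a b c : A} := transfer_mul_of_commute m l hξ (a' := a) (b' := b) (c' := c)
    hr₂ hp₂ hq₂
  have mul_s₂ {a b c : A} := transfer_mul_of_anticommute m l hξ (a' := a) (b' := b) (c' := c)
    hs₂ hq₂ hp₂
  constructor
  · simp only [mul_p₁, mul_p₂]
    simp only [mul_add, mul_smul_comm, mul_neg, neg_mul]
    linear_combination (norm := module) h.pp - k_ps + x • h.pr_sub_ss - (l * m * x) • k_rs +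
      (l * m * x ^ 2) • h.rr
  · simp only [mul_r₁, mul_r₂]
    simp only [mul_add, mul_smul_comm]
    linear_combination (norm := module) h.rr + k_qr + x • h.pr_sub_qq + (l * m * x) • k_pq +
      (l * m * x ^ 2) • h.pp
  · simp only [mul_p₁, mul_r₁, mul_s₁, mul_p₂, mul_r₂, mul_s₂]
    simp only [mul_add, mul_sub, mul_smul_comm, mul_neg, neg_mul]
    linear_combination (norm := module) h.pr_sub_ss - (l * m) • k_rs + (l ^ 2) • k_pq + k_pq_ps +
      (m ^ 2 * x + l ^ 2 * x - l ^ 2 * m ^ 2 * x) • h.pp + (2 * l * m * x) • h.rr +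
      (l * m * x) • k_qr - (l * m * x) • k_ps_pq + (l * m * x ^ 2) • h.pr_sub_qq
  · simp only [mul_p₁, mul_q₁, mul_r₁, mul_p₂, mul_q₂, mul_r₂]
    simp only [mul_add, mul_sub, mul_smul_comm, mul_neg, neg_mul]
    linear_combination (norm := module) h.pr_sub_qq - (l ^ 2) • k_rs + (l * m) • k_pq - k_rs_qr +
      (2 * l * m * x) • h.pp + (m ^ 2 * x + l ^ 2 * x - l ^ 2 * m ^ 2 * x) • h.rr -
      (l * m * x) • k_ps + (l * m * x) • k_qr_rs + (l * m * x ^ 2) • h.pr_sub_ss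
  · simp only [mul_p₁, mul_q₁, mul_r₁, mul_s₁, mul_p₂, mul_q₂, mul_r₂, mul_s₂]
    simp only [mul_add, mul_sub, mul_smul_comm, mul_neg, neg_mul]
    linear_combination (norm := module) h.pr_add_qs - (m ^ 2 + l ^ 2) • k_rs +
      (2 * l * m * x) • h.pp + (m ^ 2 * x + l ^ 2 * x) • h.rr + x • h.ss -
      (2 * l * m * x) • k_ps + (l * m * x ^ 2) • h.pr_sub_qs
  · simp only [mul_p₁, mul_q₁, mul_r₁, mul_s₁, mul_p₂, mul_q₂, mul_r₂, mul_s₂]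
    simp only [mul_add, mul_sub, mul_smul_comm, mul_neg, neg_mul]
    linear_combination (norm := module) h.pr_sub_qs + (m ^ 2 + l ^ 2) • k_pq +
      (m ^ 2 * x + l ^ 2 * x) • h.pp + (2 * l * m * x) • h.rr - x • h.qq +
      (2 * l * m * x) • k_qr + (l * m * x ^ 2) • h.pr_add_qs
  · simp only [mul_p₁, mul_q₁, mul_r₁, mul_s₁, mul_p₂, mul_q₂, mul_r₂, mul_s₂]
    simp only [mul_add, mul_sub, mul_smul_comm, mul_neg, neg_mul]
    linear_combination (norm := module) h.ss - (2 * l * m) • k_ps + (m ^ 2 + l ^ 2) • k_ps_pq -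
      (2 * l * m * x) • h.pr_sub_ss - (m ^ 2 * x + l ^ 2 * x) • h.pr_sub_qq +
      (m ^ 2 * x + l ^ 2 * x - l ^ 2 * m ^ 2 * x) • h.pr_add_qs + (2 * l * m * x) • h.pr_sub_qs +
      (l * m ^ 3 * x - l ^ 3 * m * x) • k_pq - (2 * l * m * x) • k_pq_ps - (l * m * x ^ 2) • h.qq
  · simp only [mul_p₁, mul_q₁, mul_r₁, mul_s₁, mul_p₂, mul_q₂, mul_r₂, mul_s₂]
    simp only [mul_add, mul_sub, mul_smul_comm, mul_neg, neg_mul]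
    linear_combination (norm := module) h.qq - (2 * l * m) • k_qr + (m ^ 2 + l ^ 2) • k_qr_rs +
      (m ^ 2 * x + l ^ 2 * x) • h.pr_sub_ss + (2 * l * m * x) • h.pr_sub_qq -
      (2 * l * m * x) • h.pr_add_qs +
      (-(m ^ 2 * x) - l ^ 2 * x + l ^ 2 * m ^ 2 * x) • h.pr_sub_qs +
      (l * m ^ 3 * x - l ^ 3 * m * x) • k_rs - (2 * l * m * x) • k_rs_qr - (l * m * x ^ 2) • h.ss
  · simp only [mul_p₁, mul_s₁, mul_p₂, mul_s₂]
    simp only [mul_add, mul_sub, mul_smul_comm, mul_neg, neg_mul]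
    linear_combination (norm := module) h.ps + (m ^ 2 + l ^ 2) • k_pp + (l * m * x) • h.rs +
      (l ^ 2 * x) • h.pq + x • h.pq_ps + (l * m * x) • k_pr_add_qs + (l * m * x ^ 2) • h.qr
  · simp only [mul_r₁, mul_s₁, mul_r₂, mul_s₂]
    simp only [mul_add, mul_sub, mul_smul_comm, mul_neg]
    linear_combination (norm := module) h.rs + k_pr_add_qs + x • h.qr + x • h.ps_pq +
      (2 * l * m * x) • k_pp + (l * m * x ^ 2) • h.pq
  · simp only [mul_p₁, mul_q₁, mul_p₂, mul_q₂]
    simp only [mul_add, mul_sub, mul_smul_comm, mul_neg, neg_mul]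
    linear_combination (norm := module) h.pq - k_pr_sub_qs + x • h.ps + x • h.qr_rs -
      (2 * l * m * x) • k_rr + (l * m * x ^ 2) • h.rs
  · simp only [mul_q₁, mul_r₁, mul_q₂, mul_r₂]
    simp only [mul_add, mul_sub, mul_smul_comm, mul_neg, neg_mul]
    linear_combination (norm := module) h.qr - (m ^ 2 + l ^ 2) • k_rr + (l ^ 2 * x) • h.rs +
      (l * m * x) • h.pq + x • h.rs_qr - (l * m * x) • k_pr_sub_qs + (l * m * x ^ 2) • h.ps
  · simp only [mul_p₁, mul_s₁, mul_p₂, mul_q₂, mul_s₂]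
    simp only [mul_add, mul_sub, mul_smul_comm, mul_neg, neg_mul]
    linear_combination (norm := module) h.pq_ps - (m ^ 2 + l ^ 2) • k_pr_sub_ss +
      (l * m) • k_pr_add_qs + (l ^ 2) • k_pr_sub_qs + (m ^ 2 * x - l ^ 2 * m ^ 2 * x) • h.ps +
      (l * m * x) • h.qr - (l * m * x) • h.ps_pq - (l ^ 2 * x) • h.qr_rs +
      (-(l * m ^ 3 * x) + l ^ 3 * m * x) • k_rr + (l * m * x) • k_ss + (l * m * x ^ 2) • h.rs_qr
  · simp only [mul_p₁, mul_q₁, mul_s₁, mul_p₂, mul_q₂, mul_s₂]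
    simp only [mul_add, mul_sub, mul_smul_comm, mul_neg, neg_mul]
    linear_combination (norm := module) h.ps_pq + (2 * l * m) • k_pp - k_ss +
      (m ^ 2 * x - l ^ 2 * m ^ 2 * x) • h.rs + (l * m * x) • h.pq - x • h.rs_qr +
      (2 * l * m * x) • k_pr_sub_ss - (l * m * x) • k_pr_sub_qs + (l * m * x ^ 2) • h.qr_rs
  · simp only [mul_q₁, mul_r₁, mul_q₂, mul_r₂, mul_s₂]
    simp only [mul_add, mul_sub, mul_smul_comm, mul_neg, neg_mul]
    linear_combination (norm := module) h.rs_qr + (m ^ 2 + l ^ 2) • k_pr_sub_qq -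
      (l ^ 2) • k_pr_add_qs - (l * m) • k_pr_sub_qs + (l * m * x) • h.ps +
      (m ^ 2 * x - l ^ 2 * m ^ 2 * x) • h.qr - (l ^ 2 * x) • h.ps_pq - (l * m * x) • h.qr_rs +
      (l * m ^ 3 * x - l ^ 3 * m * x) • k_pp + (l * m * x) • k_qq + (l * m * x ^ 2) • h.pq_ps
  · simp only [mul_q₁, mul_r₁, mul_s₁, mul_q₂, mul_r₂, mul_s₂]
    simp only [mul_add, mul_sub, mul_smul_comm, mul_neg, neg_mul]
    linear_combination (norm := module) h.qr_rs - (2 * l * m) • k_rr - k_qq +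
      (l * m * x) • h.rs + (m ^ 2 * x - l ^ 2 * m ^ 2 * x) • h.pq - x • h.pq_ps -
      (2 * l * m * x) • k_pr_sub_qq + (l * m * x) • k_pr_add_qs + (l * m * x ^ 2) • h.ps_pq

end TransferStep

section TransferMatrix

variable {ι K A : Type*} [CommRing K] [Ring A] [Algebra K A]

/-- The even and odd parts of the sum, over the length-`m` sublists of a list of sites, of the
products of the factors `x i ± ξ i`, with signs alternating and the last one positive. -/
def altParts (x : ι → K) (ξ : ι → A) : List ι → ℕ → A × A
  | _, 0 => (1, 0)
  | [], _ + 1 => (0, 0)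
  | i :: L, m + 1 =>
    ((altParts x ξ L (m + 1)).1 +
        (x i • (altParts x ξ L m).1 + (-1 : K) ^ m • (ξ i * (altParts x ξ L m).2)),
      (altParts x ξ L (m + 1)).2 +
        (x i • (altParts x ξ L m).2 + (-1 : K) ^ m • (ξ i * (altParts x ξ L m).1)))

variable {x : ι → K} {ξ : ι → A}

@[simp]
lemma altParts_zero (L : List ι) : altParts x ξ L 0 = (1, 0) := by
  cases L <;> simp [altParts]

lemma altParts_eq_zero (L : List ι) {m : ℕ} (hm : L.length < m) : altParts x ξ L m = 0 := by
  induction L generalizing m with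
  | nil => obtain _ | m := m <;> simp_all [altParts]
  | cons i L ih =>
    obtain _ | m := m
    · simp at hm
    · simp only [List.length_cons, add_lt_add_iff_right] at hm
      simp [altParts, ih hm, ih (hm.trans m.lt_succ_self)]

lemma altParts_mul_of_anticommute {ζ : A} (L : List ι) (hL : ∀ i ∈ L, ξ i * ζ = -(ζ * ξ i))
    (m : ℕ) :
    (altParts x ξ L m).1 * ζ = ζ * (altParts x ξ L m).1 ∧
      (altParts x ξ L m).2 * ζ = -(ζ * (altParts x ξ L m).2) := by
  induction L generalizing m with
  | nil => obtain _ | m := m <;> simp [altParts]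
  | cons i L ih =>
    obtain _ | m := m
    · simp
    · have ih := ih fun j hj => hL j (List.mem_cons_of_mem _ hj)
      have hi := hL i List.mem_cons_self
      simp only [altParts, add_mul, mul_add, smul_mul_assoc, mul_smul_comm, (ih _).1, (ih _).2,
        mul_assoc, mul_neg, ← mul_assoc ζ (ξ i), neg_mul, neg_add, smul_neg,
        ← neg_eq_iff_eq_neg.2 hi, neg_neg]
      simp only [and_self]

/-- The part of `∑ₘ lᵐ • u m` of even degree less than `2 * N` in `l`. -/
def evenGen (N : ℕ) (l : K) (u : ℕ → A) : A := ∑ j ∈ Finset.range N, l ^ (2 * j) • u (2 * j)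

/-- The part of `∑ₘ lᵐ • u m` of odd degree less than `2 * N` in `l`. -/
def oddGen (N : ℕ) (l : K) (u : ℕ → A) : A :=
  ∑ j ∈ Finset.range N, l ^ (2 * j + 1) • u (2 * j + 1)

lemma evenGen_shift (N : ℕ) (l : K) {u u' v : ℕ → A} (h₀ : u' 0 = u 0)
    (h : ∀ m, u' (m + 1) = u (m + 1) + v m) (hv : v (2 * N + 1) = 0) :
    evenGen (N + 1) l u' = evenGen (N + 1) l u + l • oddGen (N + 1) l v := by
  rw [evenGen, evenGen, oddGen, Finset.sum_range_succ', Finset.sum_range_succ',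
    Finset.sum_range_succ, hv]
  simp only [mul_add, mul_one, h, h₀, smul_add, Finset.sum_add_distrib, Finset.smul_sum, smul_smul,
    smul_zero, add_zero]
  simp only [← pow_succ', add_assoc]
  norm_num
  abel

lemma oddGen_shift (N : ℕ) (l : K) {u u' v : ℕ → A} (h : ∀ m, u' (m + 1) = u (m + 1) + v m) :
    oddGen N l u' = oddGen N l u + l • evenGen N l v := by
  simp only [evenGen, oddGen, h, smul_add, Finset.sum_add_distrib, Finset.smul_sum, smul_smul,
    ← pow_succ']

lemma evenGen_site (N : ℕ) (l y : K) (ζ : A) (a b : ℕ → A) :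
    evenGen N l (fun m => y • a m + (-1 : K) ^ m • (ζ * b m)) =
      y • evenGen N l a + ζ * evenGen N l b := by
  simp only [evenGen, smul_add, Finset.sum_add_distrib, Finset.smul_sum, Finset.mul_sum,
    pow_mul, neg_one_sq, one_pow, one_smul, mul_smul_comm, smul_comm y]

lemma oddGen_site (N : ℕ) (l y : K) (ζ : A) (a b : ℕ → A) :
    oddGen N l (fun m => y • a m + (-1 : K) ^ m • (ζ * b m)) =
      y • oddGen N l a + ζ * -oddGen N l b := by
  simp only [oddGen, smul_add, Finset.sum_add_distrib, Finset.smul_sum, Finset.mul_sum,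
    pow_add, pow_mul, neg_one_sq, one_pow, one_smul, mul_smul_comm, smul_comm y, mul_neg,
    pow_one, one_mul, neg_smul, smul_neg, Finset.sum_neg_distrib]

lemma evenGen_mul_of_commute (N : ℕ) (l : K) {u : ℕ → A} {ζ : A}
    (h : ∀ m, u m * ζ = ζ * u m) : evenGen N l u * ζ = ζ * evenGen N l u := by
  simp only [evenGen, Finset.sum_mul, Finset.mul_sum, smul_mul_assoc, mul_smul_comm, h]

lemma oddGen_mul_of_commute (N : ℕ) (l : K) {u : ℕ → A} {ζ : A}
    (h : ∀ m, u m * ζ = ζ * u m) : oddGen N l u * ζ = ζ * oddGen N l u := by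
  simp only [oddGen, Finset.sum_mul, Finset.mul_sum, smul_mul_assoc, mul_smul_comm, h]

lemma evenGen_mul_of_anticommute (N : ℕ) (l : K) {u : ℕ → A} {ζ : A}
    (h : ∀ m, u m * ζ = -(ζ * u m)) : evenGen N l u * ζ = -(ζ * evenGen N l u) := by
  simp only [evenGen, Finset.sum_mul, Finset.mul_sum, smul_mul_assoc, mul_smul_comm, h, smul_neg,
    Finset.sum_neg_distrib]

lemma oddGen_mul_of_anticommute (N : ℕ) (l : K) {u : ℕ → A} {ζ : A}
    (h : ∀ m, u m * ζ = -(ζ * u m)) : oddGen N l u * ζ = -(ζ * oddGen N l u) := by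
  simp only [oddGen, Finset.sum_mul, Finset.mul_sum, smul_mul_assoc, mul_smul_comm, h, smul_neg,
    Finset.sum_neg_distrib]

theorem exchangeRel_altParts (hsq : ∀ i, ξ i * ξ i = x i • 1)
    (hanti : ∀ i j, i ≠ j → ξ i * ξ j = -(ξ j * ξ i)) (N : ℕ) (l m : K) (L : List ι)
    (hL : L.Nodup) (hN : L.length < 2 * (N + 1)) :
    ExchangeRel l m
      (evenGen (N + 1) l fun k => (altParts x ξ L k).1)
      (evenGen (N + 1) l fun k => (altParts x ξ L k).2)
      (oddGen (N + 1) l fun k => (altParts x ξ L k).1)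
      (oddGen (N + 1) l fun k => (altParts x ξ L k).2)
      (evenGen (N + 1) m fun k => (altParts x ξ L k).1)
      (evenGen (N + 1) m fun k => (altParts x ξ L k).2)
      (oddGen (N + 1) m fun k => (altParts x ξ L k).1)
      (oddGen (N + 1) m fun k => (altParts x ξ L k).2) := by
  induction L with
  | nil =>
    have h₁ (l : K) : (evenGen (N + 1) l fun k => (altParts x ξ [] k).1) = 1 := by
      simp [evenGen, Finset.sum_range_succ', mul_add, altParts]
    have h₂ (l : K) : (evenGen (N + 1) l fun k => (altParts x ξ [] k).2) = 0 := by
      simp [evenGen, Finset.sum_range_succ', mul_add, altParts]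
    have h₃ (l : K) : (oddGen (N + 1) l fun k => (altParts x ξ [] k).1) = 0 := by
      simp [oddGen, altParts]
    have h₄ (l : K) : (oddGen (N + 1) l fun k => (altParts x ξ [] k).2) = 0 := by
      simp [oddGen, altParts]
    rw [h₁, h₁, h₂, h₂, h₃, h₃, h₄, h₄]
    constructor <;> simp
  | cons i L ih =>
    rw [List.nodup_cons] at hL
    simp only [List.length_cons] at hN
    have hz := altParts_eq_zero (x := x) (ξ := ξ) L (m := 2 * N + 1) (by lia)
    have hξ k := altParts_mul_of_anticommute (x := x) (ζ := ξ i) L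
      (fun j hj => hanti j i fun h => hL.1 (h ▸ hj)) k
    have e₁ (l : K) := evenGen_shift N l (u := fun k => (altParts x ξ L k).1)
      (u' := fun k => (altParts x ξ (i :: L) k).1) (by simp) (fun m => rfl) (by simp [hz])
    have e₂ (l : K) := evenGen_shift N l (u := fun k => (altParts x ξ L k).2)
      (u' := fun k => (altParts x ξ (i :: L) k).2) (by simp) (fun m => rfl) (by simp [hz])
    have e₃ (l : K) := oddGen_shift (N + 1) l (u := fun k => (altParts x ξ L k).1)
      (u' := fun k => (altParts x ξ (i :: L) k).1) (fun m => rfl)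
    have e₄ (l : K) := oddGen_shift (N + 1) l (u := fun k => (altParts x ξ L k).2)
      (u' := fun k => (altParts x ξ (i :: L) k).2) (fun m => rfl)
    rw [e₁, e₁, e₂, e₂, e₃, e₃, e₄, e₄]
    simp only [evenGen_site, oddGen_site]
    exact ExchangeRel.step (hsq i)
      (evenGen_mul_of_commute _ _ fun k => (hξ k).1)
      (evenGen_mul_of_anticommute _ _ fun k => (hξ k).2)
      (oddGen_mul_of_commute _ _ fun k => (hξ k).1)
      (oddGen_mul_of_anticommute _ _ fun k => (hξ k).2)
      (evenGen_mul_of_commute _ _ fun k => (hξ k).1)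
      (evenGen_mul_of_anticommute _ _ fun k => (hξ k).2)
      (oddGen_mul_of_commute _ _ fun k => (hξ k).1)
      (oddGen_mul_of_anticommute _ _ fun k => (hξ k).2)
      (ih hL.2 (by lia))

lemma eq_zero_of_forall_sum_pow_smul_eq_zero {F V : Type*} [Field F] [Infinite F]
    [AddCommGroup V] [Module F V] (N : ℕ) (c : ℕ → V)
    (h : ∀ l : F, ∑ a ∈ Finset.range N, l ^ (2 * a) • c a = 0) {a : ℕ} (ha : a < N) : c a = 0 := by
  rw [← Module.forall_dual_apply_eq_zero_iff F]
  intro f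
  have hP : ∑ a ∈ Finset.range N, Polynomial.monomial (2 * a) (f (c a)) = 0 := by
    refine Polynomial.funext fun l => ?_
    simpa [Polynomial.eval_finsetSum, mul_comm] using congrArg f (h l)
  have := congrArg (fun P => Polynomial.coeff P (2 * a)) hP
  simp only [Polynomial.finsetSum_coeff, Polynomial.coeff_monomial, Nat.mul_left_cancel_iff,
    Nat.ofNat_pos, Finset.sum_ite_eq', Finset.mem_range, Polynomial.coeff_zero] at this
  rwa [if_pos ha] at this

theorem altParts_fst_commute {F : Type*} [Field F] [Infinite F] [Algebra F K] [Algebra F A]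
    [IsScalarTower F K A] (hsq : ∀ i, ξ i * ξ i = x i • 1)
    (hanti : ∀ i j, i ≠ j → ξ i * ξ j = -(ξ j * ξ i)) (L : List ι) (hL : L.Nodup) (a b : ℕ) :
    (altParts x ξ L (2 * a)).1 * (altParts x ξ L (2 * b)).1 =
      (altParts x ξ L (2 * b)).1 * (altParts x ξ L (2 * a)).1 := by
  set N := L.length + a + b
  have key (l m : F) := (exchangeRel_altParts (x := x) hsq hanti N (algebraMap F K l)
    (algebraMap F K m) L hL (by lia)).pp
  simp only [evenGen, ← map_pow, algebraMap_smul] at key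
  have h₁ (l : F) := eq_zero_of_forall_sum_pow_smul_eq_zero (F := F) (N + 1)
    (fun b => (∑ j ∈ Finset.range (N + 1), l ^ (2 * j) • (altParts x ξ L (2 * j)).1) *
        (altParts x ξ L (2 * b)).1 - (altParts x ξ L (2 * b)).1 *
          ∑ j ∈ Finset.range (N + 1), l ^ (2 * j) • (altParts x ξ L (2 * j)).1)
    (fun m => by
      rw [← key l m]
      generalize ∑ j ∈ Finset.range (N + 1), l ^ (2 * j) • (altParts x ξ L (2 * j)).1 = U
      simp only [smul_sub, Finset.sum_sub_distrib, Finset.mul_sum, Finset.sum_mul, mul_smul_comm,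
        smul_mul_assoc])
    (a := b) (by lia)
  refine sub_eq_zero.1 (eq_zero_of_forall_sum_pow_smul_eq_zero (F := F) (N + 1)
    (fun a => (altParts x ξ L (2 * a)).1 * (altParts x ξ L (2 * b)).1 -
      (altParts x ξ L (2 * b)).1 * (altParts x ξ L (2 * a)).1) (fun l => ?_) (a := a) (by lia))
  rw [← h₁ l]
  simp only [smul_sub, Finset.sum_sub_distrib, Finset.mul_sum, Finset.sum_mul, mul_smul_comm,
    smul_mul_assoc]

end TransferMatrix

section Sublists

variable {ι K A : Type*} [CommRing K] [Ring A] [Algebra K A]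

lemma sum_sublistsLen_mapIdx_prod (x : ι → K) (ξ : ι → A) (L : List ι) (m : ℕ) :
    ((L.sublistsLen m).map fun l => (l.mapIdx fun t i =>
        algebraMap K A (x i) + (-1 : K) ^ (m - 1 - t) • ξ i).prod).sum =
      (altParts x ξ L m).1 + (altParts x ξ L m).2 := by
  induction L generalizing m with
  | nil => obtain _ | m := m <;> simp [altParts]
  | cons i L ih =>
    obtain _ | m := m
    · simp
    · have ih₁ := ih (m + 1)
      have ih₂ := ih m
      simp only [Nat.add_sub_cancel] at ih₁
      simp only [Nat.sub_sub, Nat.add_comm 1] at ih₂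
      simp only [List.sublistsLen_succ_cons, List.map_append, List.sum_append, Nat.add_sub_cancel,
        List.map_map, Function.comp_def, List.mapIdx_cons, List.prod_cons, Nat.sub_zero,
        List.sum_map_mul_left, ih₁, altParts, ih₂]
      simp only [add_mul, mul_add, Algebra.smul_def, mul_assoc]
      abel

lemma sum_powersetCard_univ_sort {n : ℕ} {B : Type*} [AddCommMonoid B] (m : ℕ)
    (f : List (Fin n) → B) :
    ∑ s ∈ (Finset.univ : Finset (Fin n)).powersetCard m, f (s.sort (· ≤ ·)) =
      (((List.finRange n).sublistsLen m).map f).sum := by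
  have h : ∑ s ∈ (Finset.univ : Finset (Fin n)).powersetCard m, f (s.sort (· ≤ ·)) =
      (((Finset.univ.powersetCard m).val.map Finset.val).map
        fun s : Multiset (Fin n) => f (s.sort (· ≤ ·))).sum := by
    rw [Multiset.map_map]
    rfl
  rw [h, Finset.map_val_val_powersetCard, Fin.univ_def, Multiset.powersetCard_coe,
    Multiset.map_coe, Multiset.sum_coe, List.map_map]
  congr 1
  refine List.map_congr_left fun l hl => ?_
  have hl : l.Pairwise (· ≤ ·) :=
    (List.pairwise_le_finRange n).sublist (List.mem_sublistsLen.1 hl).1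
  simp only [Function.comp_apply, Multiset.coe_sort]
  rw [List.mergeSort_of_pairwise (by simpa using hl)]

end Sublists

/-- The alternating sums for the generators `ξ i` of the Clifford algebra. -/
abbrev cliffParts (n : ℕ) :
    List (Fin n) → ℕ → CliffordAlgebra (Qform n) × CliffordAlgebra (Qform n) :=
  altParts (fun i => (X i : MvPolynomial (Fin n) ℂ))
    (fun i => CliffordAlgebra.ι (Qform n) (Pi.single i 1))

lemma sum_cliffFactors (n m : ℕ) :
    ∑ s ∈ Finset.univ.powersetCard m, cliffFactors n m s =
      (cliffParts n (List.finRange n) m).1 + (cliffParts n (List.finRange n) m).2 := by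
  rw [← sum_sublistsLen_mapIdx_prod, ← sum_powersetCard_univ_sort]
  rfl

lemma cliffParts_mem_evenOdd (n : ℕ) (L : List (Fin n)) (m : ℕ) :
    (cliffParts n L m).1 ∈ CliffordAlgebra.evenOdd (Qform n) 0 ∧
      (cliffParts n L m).2 ∈ CliffordAlgebra.evenOdd (Qform n) 1 := by
  have h₁ : (1 : CliffordAlgebra (Qform n)) ∈ CliffordAlgebra.evenOdd (Qform n) 0 :=
    SetLike.GradedOne.one_mem
  have hmul (i j : ZMod 2) {a b : CliffordAlgebra (Qform n)}
      (ha : a ∈ CliffordAlgebra.evenOdd (Qform n) i)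
      (hb : b ∈ CliffordAlgebra.evenOdd (Qform n) j) :
      a * b ∈ CliffordAlgebra.evenOdd (Qform n) (i + j) := SetLike.GradedMul.mul_mem ha hb
  induction L generalizing m with
  | nil =>
    obtain _ | m := m <;> simp [altParts, h₁]
  | cons i L ih =>
    obtain _ | m := m
    · simp [h₁]
    · have hi := CliffordAlgebra.ι_mem_evenOdd_one (Qform n) (Pi.single i 1)
      exact ⟨add_mem (ih _).1 (add_mem (Submodule.smul_mem _ _ (ih _).1)
          (Submodule.smul_mem _ _ (hmul 1 1 hi (ih m).2))),
        add_mem (ih _).2 (add_mem (Submodule.smul_mem _ _ (ih _).2)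
          (Submodule.smul_mem _ _ (hmul 1 0 hi (ih m).1)))⟩

lemma zel_of_even {n k : ℕ} (hk : Even k) :
    zel n k = algebraMap (MvPolynomial (Fin n) ℂ) (CliffordAlgebra (Qform n)) (zeta n k) :=
  if_pos hk

lemma zel_of_odd {n k : ℕ} (hk : ¬Even k) :
    zel n k = (cliffParts n (List.finRange n) (k + 1)).1 := by
  rw [zel, if_neg hk, sum_cliffFactors, DirectSum.decompose_add, DirectSum.add_apply,
    Submodule.coe_add, DirectSum.decompose_of_mem_same _ (cliffParts_mem_evenOdd n _ _).1,
    DirectSum.decompose_of_mem_ne _ (cliffParts_mem_evenOdd n _ _).2 (by decide), add_zero]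

lemma Qform_single (n : ℕ) (i : Fin n) : Qform n (Pi.single i 1) = X i := by
  simp [Qform, QuadraticMap.weightedSumSquares_apply, Pi.single_apply]

lemma ι_single_mul_ι_single_self (n : ℕ) (i : Fin n) :
    CliffordAlgebra.ι (Qform n) (Pi.single i 1) * CliffordAlgebra.ι (Qform n) (Pi.single i 1) =
      (X i : MvPolynomial (Fin n) ℂ) • (1 : CliffordAlgebra (Qform n)) := by
  rw [CliffordAlgebra.ι_sq_scalar, Qform_single, Algebra.algebraMap_eq_smul_one]

lemma Qform_polar_single (n : ℕ) {i j : Fin n} (hij : i ≠ j) :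
    QuadraticMap.polar (Qform n) (Pi.single i 1) (Pi.single j 1) = 0 := by
  simp only [QuadraticMap.polar, Qform, QuadraticMap.weightedSumSquares_apply,
    ← Finset.sum_sub_distrib]
  refine Finset.sum_eq_zero fun k _ => ?_
  by_cases hi : k = i <;> by_cases hj : k = j <;> simp_all

lemma ι_single_mul_ι_single_of_ne (n : ℕ) (i j : Fin n) (hij : i ≠ j) :
    CliffordAlgebra.ι (Qform n) (Pi.single i 1) * CliffordAlgebra.ι (Qform n) (Pi.single j 1) =
      -(CliffordAlgebra.ι (Qform n) (Pi.single j 1) *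
        CliffordAlgebra.ι (Qform n) (Pi.single i 1)) := by
  rw [eq_neg_iff_add_eq_zero, CliffordAlgebra.ι_mul_ι_add_swap, Qform_polar_single n hij, map_zero]

theorem zel_commute (n a b : ℕ) : zel n a * zel n b = zel n b * zel n a := by
  by_cases ha : Even a
  · rw [zel_of_even ha]
    exact Algebra.commutes _ _
  by_cases hb : Even b
  · rw [zel_of_even hb]
    exact (Algebra.commutes _ _).symm
  rw [zel_of_odd ha, zel_of_odd hb]
  obtain ⟨a, rfl⟩ := Nat.not_even_iff_odd.1 ha
  obtain ⟨b, rfl⟩ := Nat.not_even_iff_odd.1 hb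
  exact altParts_fst_commute (F := ℂ) (ι_single_mul_ι_single_self n)
    (ι_single_mul_ι_single_of_ne n) _ (List.nodup_finRange n) (a + 1) (b + 1)

section Zeta

open Finset

lemma coeff_prod_one_add_C_mul_X {σ : Type*} [Fintype σ] {K : Type*} [CommRing K]
    (c : MvPolynomial σ K) (m : ℕ) :
    (∏ i : σ, (1 + Polynomial.C (c * X i) * Polynomial.X)).coeff m = c ^ m * esymm σ K m := by
  classical
  simp only [prod_one_add, prod_mul_distrib, prod_const, ← map_prod, Polynomial.finsetSum_coeff,
    Polynomial.coeff_C_mul_X_pow, ← sum_filter, esymm, mul_sum, powersetCard_eq_filter, eq_comm]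
  exact sum_congr rfl fun t ht => by rw [(mem_filter.1 ht).2]

variable {B : Type*} [CommRing B]

/-- The product of `1 - y j` for `j < i` and of `1 + y j` for `i ≤ j < n`. -/
def mixedProd (y : ℕ → B) (n i : ℕ) : B :=
  (∏ j ∈ range i, (1 - y j)) * ∏ j ∈ Ico i n, (1 + y j)

/-- The product of `1 - y j` for `j < i` and of `1 + y j` for `i < j < n`. -/
def puncturedProd (y : ℕ → B) (n i : ℕ) : B :=
  (∏ j ∈ range i, (1 - y j)) * ∏ j ∈ Ico (i + 1) n, (1 + y j)

lemma mixedProd_eq (y : ℕ → B) {n i : ℕ} (hi : i < n) :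
    mixedProd y n i = (1 + y i) * puncturedProd y n i := by
  rw [mixedProd, puncturedProd, prod_eq_prod_Ico_succ_bot hi]
  ring

lemma mixedProd_succ (y : ℕ → B) (n i : ℕ) :
    mixedProd y n (i + 1) = (1 - y i) * puncturedProd y n i := by
  rw [mixedProd, puncturedProd, prod_range_succ]
  ring

lemma sum_range_signed_sub (P : ℕ → B) {n i : ℕ} (hi : i < n) :
    ∑ j ∈ range n, (if i < j then P j - P (j + 1) else if j < i then P (j + 1) - P j else 0) =
      P i + P (i + 1) - (P 0 + P n) := by
  have h (k : ℕ) (hk : k ≤ i) :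
      ∑ j ∈ range k, (if i < j then P j - P (j + 1) else if j < i then P (j + 1) - P j else 0) =
        P k - P 0 := by
    rw [← sum_range_sub]
    refine sum_congr rfl fun j hj => ?_
    rw [if_neg (by simp at hj; lia), if_pos (by simp at hj; lia)]
  induction n, hi using Nat.le_induction with
  | base => simp [sum_range_succ, h i le_rfl]
  | succ n hn ih =>
    rw [sum_range_succ, ih, if_pos (by lia)]
    ring

lemma two_mul_sum_signed_puncturedProd (y : ℕ → B) {n i : ℕ} (hi : i < n) :
    2 * ∑ j ∈ range n, (if i < j then y j * puncturedProd y n j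
        else if j < i then -(y j * puncturedProd y n j) else 0) =
      2 * puncturedProd y n i - (mixedProd y n 0 + mixedProd y n n) := by
  have h₂ : mixedProd y n i + mixedProd y n (i + 1) = 2 * puncturedProd y n i := by
    rw [mixedProd_eq y hi, mixedProd_succ]
    ring
  rw [← h₂, ← sum_range_signed_sub _ hi, mul_sum]
  refine sum_congr rfl fun j hj => ?_
  rw [mixedProd_eq y (mem_range.1 hj), mixedProd_succ]
  split_ifs <;> ring

lemma two_mul_sum_puncturedProd (y : ℕ → B) (n : ℕ) :
    2 * ∑ j ∈ range n, y j * puncturedProd y n j = mixedProd y n 0 - mixedProd y n n := by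
  rw [← sum_range_sub', mul_sum]
  refine sum_congr rfl fun j hj => ?_
  rw [mixedProd_eq y (mem_range.1 hj), mixedProd_succ]
  ring

/-- The sequence `j ↦ x_j * t`, extended by zero, of polynomials in `t`. -/
def linSeq (n j : ℕ) : Polynomial (MvPolynomial (Fin n) ℂ) :=
  if h : j < n then Polynomial.C (X ⟨j, h⟩) * Polynomial.X else 0

lemma linSeq_coe {n : ℕ} (i : Fin n) :
    linSeq n i = Polynomial.C (X i) * Polynomial.X := dif_pos i.2

lemma coeff_mixedProd_zero (n m : ℕ) :
    (mixedProd (linSeq n) n 0).coeff m = esymm (Fin n) ℂ m := by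
  have h := coeff_prod_one_add_C_mul_X (σ := Fin n) (K := ℂ) 1 m
  rw [one_pow, one_mul] at h
  rw [← h, mixedProd, range_zero, prod_empty, one_mul, ← range_eq_Ico,
    ← Fin.prod_univ_eq_prod_range]
  simp only [linSeq_coe, one_mul]

lemma coeff_mixedProd_self (n m : ℕ) :
    (mixedProd (linSeq n) n n).coeff m = (-1) ^ m * esymm (Fin n) ℂ m := by
  rw [← coeff_prod_one_add_C_mul_X, mixedProd, Ico_self, prod_empty, mul_one,
    ← Fin.prod_univ_eq_prod_range]
  refine congrArg (fun p => Polynomial.coeff p m) (prod_congr rfl fun i _ => ?_)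
  rw [linSeq_coe, map_mul, map_neg, map_one]
  ring

/-- The vector of coefficients of the punctured products in a given degree. -/
def puncturedCoeff (n k : ℕ) (i : Fin n) : MvPolynomial (Fin n) ℂ :=
  (puncturedProd (linSeq n) n i).coeff k

/-- The elementary symmetric polynomial of degree `k` if `k` is even, and zero otherwise. -/
def evenEsymm (n k : ℕ) : MvPolynomial (Fin n) ℂ := if Even k then esymm (Fin n) ℂ k else 0

lemma coeff_mixedProd_add (n k : ℕ) :
    (mixedProd (linSeq n) n 0 + mixedProd (linSeq n) n n).coeff k = 2 * evenEsymm n k := by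
  rw [Polynomial.coeff_add, coeff_mixedProd_zero, coeff_mixedProd_self, evenEsymm]
  split_ifs with h
  · rw [h.neg_one_pow]
    ring
  · rw [(Nat.not_even_iff_odd.1 h).neg_one_pow]
    ring

lemma puncturedCoeff_zero (n : ℕ) : puncturedCoeff n 0 = fun _ => 1 := by
  funext i
  have h (j : ℕ) : (linSeq n j).coeff 0 = 0 := by
    rw [linSeq]
    split_ifs <;> simp
  simp [puncturedCoeff, puncturedProd, Polynomial.coeff_zero_eq_eval_zero, Polynomial.eval_prod,
    ← Polynomial.coeff_zero_eq_eval_zero (linSeq n _), h]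

lemma puncturedCoeff_succ (n k : ℕ) :
    puncturedCoeff n (k + 1) =
      Tmat n *ᵥ puncturedCoeff n k + evenEsymm n (k + 1) • fun _ => 1 := by
  funext i
  have h := congrArg (fun p => Polynomial.coeff p (k + 1))
    (two_mul_sum_signed_puncturedProd (linSeq n) i.2)
  simp only [← map_ofNat Polynomial.C, Polynomial.coeff_sub, Polynomial.coeff_C_mul,
    coeff_mixedProd_add] at h
  rw [← mul_sub] at h
  have h := mul_left_cancel₀ two_ne_zero h
  rw [← Fin.sum_univ_eq_sum_range fun j => if i < j then linSeq n j * puncturedProd (linSeq n) n j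
        else if j < i then -(linSeq n j * puncturedProd (linSeq n) n j) else 0] at h
  rw [Pi.add_apply, puncturedCoeff, ← sub_eq_iff_eq_add]
  simp only [Pi.smul_apply, smul_eq_mul, mul_one]
  rw [← h, Polynomial.finsetSum_coeff, mulVec, dotProduct]
  refine sum_congr rfl fun j _ => ?_
  simp only [Tmat, of_apply, linSeq_coe, puncturedCoeff, Fin.val_fin_lt]
  split_ifs <;> simp [mul_assoc, Polynomial.coeff_X_mul]

lemma puncturedCoeff_eq_sum (n k : ℕ) :
    puncturedCoeff n k =
      ∑ j ∈ range (k + 1), evenEsymm n j • ((Tmat n ^ (k - j)) *ᵥ fun _ => 1) := by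
  induction k with
  | zero => simp [puncturedCoeff_zero, evenEsymm]
  | succ k ih =>
    rw [puncturedCoeff_succ, ih, sum_range_succ _ (k + 1), Matrix.mulVec_sum]
    simp only [Nat.sub_self, pow_zero, one_mulVec]
    congr 1
    refine sum_congr rfl fun j hj => ?_
    rw [mulVec_smul, mulVec_mulVec, ← pow_succ', Nat.succ_sub (by simp at hj; lia)]

lemma sum_X_mul_puncturedCoeff {n k : ℕ} (hk : Even k) :
    ∑ i, X i * puncturedCoeff n k i = esymm (Fin n) ℂ (k + 1) := by
  have h := congrArg (fun p => Polynomial.coeff p (k + 1))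
    (two_mul_sum_puncturedProd (linSeq n) n)
  simp only [← map_ofNat Polynomial.C, Polynomial.coeff_sub, Polynomial.coeff_C_mul,
    coeff_mixedProd_zero, coeff_mixedProd_self, hk.add_one.neg_one_pow, neg_one_mul, sub_neg_eq_add,
    ← two_mul] at h
  have h := mul_left_cancel₀ two_ne_zero h
  rw [← h, ← Fin.sum_univ_eq_sum_range fun j => linSeq n j * puncturedProd (linSeq n) n j,
    Polynomial.finsetSum_coeff]
  refine sum_congr rfl fun j _ => ?_
  simp [linSeq_coe, puncturedCoeff, mul_assoc, Polynomial.coeff_X_mul]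

/-- The odd elementary symmetric polynomials expressed through the `ζ_k` and the even ones. -/
theorem esymm_succ_eq_sum_zeta {n k : ℕ} (hk : Even k) :
    esymm (Fin n) ℂ (k + 1) = ∑ j ∈ range (k + 1), evenEsymm n j * zeta n (k - j) := by
  rw [← sum_X_mul_puncturedCoeff hk, puncturedCoeff_eq_sum]
  simp only [zeta, dotProduct, mulVec_diagonal, one_mul, Finset.sum_apply, Pi.smul_apply,
    smul_eq_mul, mul_sum]
  rw [sum_comm]
  exact sum_congr rfl fun j _ => sum_congr rfl fun i _ => by ring

end Zeta

section LeadingPolynomials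

/-- The polynomials that turn out to be the leading terms of the elements `z_k`. -/
def leadPoly (n k : ℕ) : MvPolynomial (Fin n) ℂ :=
  if Even k then zeta n k else esymm (Fin n) ℂ (k + 1)

/-- The variable `X k` if `k < n`, and zero otherwise. -/
def natX (n k : ℕ) : MvPolynomial (Fin n) ℂ := if h : k < n then X ⟨k, h⟩ else 0

lemma natX_coe {n : ℕ} (k : Fin n) : natX n k = X k := dif_pos k.2

lemma aeval_leadPoly_natX {n k : ℕ} (hk : k < n) :
    aeval (fun i : Fin n => leadPoly n i) (natX n k) = leadPoly n k := by
  rw [natX, dif_pos hk, aeval_X]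

/-- The expression of the elementary symmetric polynomial of degree `k + 1` in terms of the
leading polynomials. -/
def esymmExpr (n k : ℕ) : MvPolynomial (Fin n) ℂ :=
  if Even k then natX n k + ∑ j ∈ Finset.range k,
    (if Even (j + 1) then natX n j else 0) * natX n (k - (j + 1)) else natX n k

lemma aeval_leadPoly_esymmExpr {n k : ℕ} (hk : k < n) :
    aeval (fun i : Fin n => leadPoly n i) (esymmExpr n k) = esymm (Fin n) ℂ (k + 1) := by
  rw [esymmExpr]
  split_ifs with h
  · rw [esymm_succ_eq_sum_zeta h, Finset.sum_range_succ', map_add, aeval_leadPoly_natX hk, leadPoly,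
      if_pos h, map_sum, add_comm]
    simp only [evenEsymm, Even.zero, if_true, esymm_zero, one_mul, Nat.sub_zero, add_left_inj]
    refine Finset.sum_congr rfl fun j hj => ?_
    have hj := Finset.mem_range.1 hj
    split_ifs with hj'
    · rw [map_mul, aeval_leadPoly_natX (by lia), aeval_leadPoly_natX (by lia), leadPoly, leadPoly,
        if_neg (by grind), if_pos (by grind)]
    · simp
  · rw [aeval_leadPoly_natX hk, leadPoly, if_neg h]

lemma aeval_esymmExpr_surjective (n : ℕ) :
    Function.Surjective (aeval fun i : Fin n => esymmExpr n i :
      MvPolynomial (Fin n) ℂ →ₐ[ℂ] MvPolynomial (Fin n) ℂ) := by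
  set σ : MvPolynomial (Fin n) ℂ →ₐ[ℂ] MvPolynomial (Fin n) ℂ :=
    aeval fun i : Fin n => esymmExpr n i with hσ
  have key (k : ℕ) (hk : k < n) : natX n k ∈ σ.range := by
    induction k using Nat.strong_induction_on with
    | _ k ih =>
      have h : esymmExpr n k ∈ σ.range := ⟨X ⟨k, hk⟩, by simp [hσ]⟩
      rw [esymmExpr] at h
      split_ifs at h with hk'
      · refine (add_mem_cancel_right (sum_mem fun j hj => ?_)).1 h
        have hj := Finset.mem_range.1 hj
        refine mul_mem ?_ (ih _ (by lia) (by lia))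
        split_ifs
        exacts [ih j hj (by lia), zero_mem _]
      · exact h
  rw [← AlgHom.range_eq_top, eq_top_iff, ← adjoin_range_X, Algebra.adjoin_le_iff]
  rintro _ ⟨k, rfl⟩
  rw [← natX_coe]
  exact key k k.2

theorem aeval_leadPoly_injective (n : ℕ) :
    Function.Injective (aeval fun i : Fin n => leadPoly n i :
      MvPolynomial (Fin n) ℂ →ₐ[ℂ] MvPolynomial (Fin n) ℂ) := by
  refine (injective_iff_map_eq_zero _).2 fun P hP => ?_
  obtain ⟨P, rfl⟩ := aeval_esymmExpr_surjective n P
  have h : (aeval fun i : Fin n => leadPoly n i).comp (aeval fun i : Fin n => esymmExpr n i) =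
      (symmetricSubalgebra (Fin n) ℂ).val.comp (esymmAlgHom (Fin n) ℂ n) := by
    ext k : 1
    rw [AlgHom.comp_apply, aeval_X, aeval_leadPoly_esymmExpr k.2]
    simp [esymmAlgHom_apply]
  rw [← AlgHom.comp_apply, h] at hP
  have hP : esymmAlgHom (Fin n) ℂ n P = 0 := Subtype.ext hP
  rw [(injective_iff_map_eq_zero _).1 (esymmAlgHom_fin_injective ℂ le_rfl) _ hP, map_zero]

end LeadingPolynomials

section Dilation

/-- Polynomials over the Clifford algebra, viewed as an algebra over the base ring through the
dilation `x_i ↦ x_i * t ^ 2`. -/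
def DilatedClifford (n : ℕ) : Type := Polynomial (CliffordAlgebra (Qform n))

instance (n : ℕ) : Ring (DilatedClifford n) :=
  inferInstanceAs (Ring (Polynomial (CliffordAlgebra (Qform n))))

/-- The identification of a type synonym with the underlying polynomial ring. -/
def toDilated (n : ℕ) : Polynomial (CliffordAlgebra (Qform n)) ≃+* DilatedClifford n :=
  RingEquiv.refl _

/-- The homomorphism `x_i ↦ x_i * t ^ 2`. -/
def dilation (n : ℕ) : MvPolynomial (Fin n) ℂ →ₐ[ℂ] Polynomial (MvPolynomial (Fin n) ℂ) :=
  aeval fun i => Polynomial.C (X i) * Polynomial.X ^ 2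

instance (n : ℕ) : Algebra (MvPolynomial (Fin n) ℂ) (DilatedClifford n) :=
  letI := Polynomial.algebra (R := MvPolynomial (Fin n) ℂ) (A := CliffordAlgebra (Qform n))
  Algebra.compHom (Polynomial (CliffordAlgebra (Qform n))) (dilation n).toRingHom

lemma algebraMap_dilatedClifford (n : ℕ) (p : MvPolynomial (Fin n) ℂ) :
    algebraMap (MvPolynomial (Fin n) ℂ) (DilatedClifford n) p =
      toDilated n ((dilation n p).map (algebraMap _ _)) := rfl

/-- The linear map `e_i ↦ ξ_i * t`. -/
def dilatedι (n : ℕ) :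
    (Fin n → MvPolynomial (Fin n) ℂ) →ₗ[MvPolynomial (Fin n) ℂ] DilatedClifford n :=
  (Pi.basisFun _ (Fin n)).constr (MvPolynomial (Fin n) ℂ) fun i =>
    toDilated n (Polynomial.C (CliffordAlgebra.ι (Qform n) (Pi.single i 1)) * Polynomial.X)

lemma dilatedι_single (n : ℕ) (i : Fin n) :
    dilatedι n (Pi.single i 1) =
      toDilated n (Polynomial.C (CliffordAlgebra.ι (Qform n) (Pi.single i 1)) * Polynomial.X) := by
  rw [dilatedι, ← Pi.basisFun_apply, Module.Basis.constr_basis, Pi.basisFun_apply]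

lemma dilatedι_mul_self (n : ℕ) (m : Fin n → MvPolynomial (Fin n) ℂ) :
    dilatedι n m * dilatedι n m = algebraMap _ _ (Qform n m) := by
  have h2 : IsUnit (2 : DilatedClifford n) := by
    have h := ((isUnit_iff_ne_zero.2 (two_ne_zero' ℂ)).map (C (σ := Fin n))).map
      (algebraMap _ (DilatedClifford n))
    simpa only [map_ofNat] using h
  revert m
  rw [CliffordAlgebra.forall_mul_self_eq_iff h2]
  refine (Pi.basisFun _ (Fin n)).ext fun i => (Pi.basisFun _ (Fin n)).ext fun j => ?_
  simp only [Pi.basisFun_apply]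
  change dilatedι n (Pi.single i 1) * dilatedι n (Pi.single j 1) +
    dilatedι n (Pi.single j 1) * dilatedι n (Pi.single i 1) =
      algebraMap _ _ (QuadraticMap.polar (Qform n) (Pi.single i 1) (Pi.single j 1))
  have key (i j : Fin n) : dilatedι n (Pi.single i 1) * dilatedι n (Pi.single j 1) =
      toDilated n (Polynomial.C (CliffordAlgebra.ι (Qform n) (Pi.single i 1) *
          CliffordAlgebra.ι (Qform n) (Pi.single j 1)) * Polynomial.X ^ 2) := by
    rw [dilatedι_single, dilatedι_single, map_mul Polynomial.C, pow_two, ← map_mul, mul_assoc,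
      ← mul_assoc Polynomial.X, Polynomial.X_mul_C, mul_assoc, mul_assoc]
  rw [key, key, ← map_add, ← add_mul, ← map_add, CliffordAlgebra.ι_mul_ι_add_swap,
    algebraMap_dilatedClifford]
  congr 1
  by_cases hij : i = j
  · subst hij
    rw [QuadraticMap.polar_self, Qform_single, two_smul]
    simp [dilation, add_mul]
  · simp [Qform_polar_single n hij]

/-- The homomorphism from the Clifford algebra given by `x_i ↦ x_i * t ^ 2` and `ξ_i ↦ ξ_i * t`. -/
def cliffDilation (n : ℕ) :
    CliffordAlgebra (Qform n) →+* Polynomial (CliffordAlgebra (Qform n)) :=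
  (toDilated n).symm.toRingHom.comp
    (CliffordAlgebra.lift (Qform n) ⟨dilatedι n, dilatedι_mul_self n⟩).toRingHom

lemma cliffDilation_algebraMap (n : ℕ) (p : MvPolynomial (Fin n) ℂ) :
    cliffDilation n (algebraMap _ _ p) = (dilation n p).map (algebraMap _ _) :=
  (toDilated n).symm_apply_eq.2 <|
    (CliffordAlgebra.lift (Qform n) ⟨dilatedι n, dilatedι_mul_self n⟩).commutes p

lemma cliffDilation_ι_single (n : ℕ) (i : Fin n) :
    cliffDilation n (CliffordAlgebra.ι (Qform n) (Pi.single i 1)) =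
      Polynomial.C (CliffordAlgebra.ι (Qform n) (Pi.single i 1)) * Polynomial.X :=
  (toDilated n).symm_apply_eq.2 ((CliffordAlgebra.lift_ι_apply _ _ _).trans (dilatedι_single n i))

end Dilation

section LeadingCoefficients

variable {B : Type*} [Ring B]

/-- The polynomial `f` has degree at most `d`, and `c` is its coefficient of degree `d`. -/
def HasLead (f : Polynomial B) (d : ℕ) (c : B) : Prop := f.natDegree ≤ d ∧ f.coeff d = c

namespace HasLead

variable {f g : Polynomial B} {d e : ℕ} {a b : B}

lemma zero (d : ℕ) : HasLead (0 : Polynomial B) d 0 := by simp [HasLead]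

lemma monomial (d : ℕ) (a : B) : HasLead (Polynomial.C a * Polynomial.X ^ d) d a :=
  ⟨Polynomial.natDegree_C_mul_X_pow_le a d, by simp⟩

lemma add (hf : HasLead f d a) (hg : HasLead g d b) : HasLead (f + g) d (a + b) :=
  ⟨Polynomial.natDegree_add_le_of_degree_le hf.1 hg.1, by rw [Polynomial.coeff_add, hf.2, hg.2]⟩

lemma mul (hf : HasLead f d a) (hg : HasLead g e b) : HasLead (f * g) (d + e) (a * b) :=
  ⟨Polynomial.natDegree_mul_le_of_le hf.1 hg.1, by
    rw [Polynomial.coeff_mul_add_eq_of_natDegree_le hf.1 hg.1, hf.2, hg.2]⟩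

lemma of_lt (hf : HasLead f d a) (h : d < e) : HasLead f e 0 :=
  ⟨hf.1.trans h.le, Polynomial.coeff_eq_zero_of_natDegree_lt (hf.1.trans_lt h)⟩

end HasLead

lemma coeff_prod_map_one_add_cons {ι K : Type*} [CommRing K] (x : ι → K) (i : ι) (L : List ι)
    (m : ℕ) :
    ((i :: L).map fun i => 1 + Polynomial.C (x i) * Polynomial.X).prod.coeff (m + 1) =
      (L.map fun i => 1 + Polynomial.C (x i) * Polynomial.X).prod.coeff (m + 1) +
        x i * (L.map fun i => 1 + Polynomial.C (x i) * Polynomial.X).prod.coeff m := by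
  rw [List.map_cons, List.prod_cons, add_mul, one_mul, Polynomial.coeff_add, mul_assoc,
    Polynomial.coeff_C_mul, Polynomial.coeff_X_mul]

lemma coeff_prod_map_one_add_zero {ι K : Type*} [CommRing K] (x : ι → K) (L : List ι) :
    (L.map fun i => 1 + Polynomial.C (x i) * Polynomial.X).prod.coeff 0 = 1 := by
  induction L with
  | nil => simp
  | cons i L ih => simp [Polynomial.mul_coeff_zero, ih]

lemma hasLead_cliffDilation_X (n : ℕ) (i : Fin n) :
    HasLead (cliffDilation n (algebraMap (MvPolynomial (Fin n) ℂ) _ (X i))) 2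
      (algebraMap (MvPolynomial (Fin n) ℂ) _ (X i)) := by
  rw [cliffDilation_algebraMap]
  simpa [dilation] using HasLead.monomial 2
    (algebraMap (MvPolynomial (Fin n) ℂ) (CliffordAlgebra (Qform n)) (X i))

lemma hasLead_cliffDilation_ι_single (n : ℕ) (i : Fin n) :
    HasLead (cliffDilation n (CliffordAlgebra.ι (Qform n) (Pi.single i 1))) 2 0 := by
  rw [cliffDilation_ι_single, ← pow_one Polynomial.X]
  exact (HasLead.monomial 1 _).of_lt one_lt_two

lemma hasLead_cliffDilation_neg_one_pow (n m : ℕ) :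
    HasLead (cliffDilation n (algebraMap (MvPolynomial (Fin n) ℂ) _ ((-1) ^ m))) 0 ((-1) ^ m) := by
  simpa using HasLead.monomial 0 ((-1 : CliffordAlgebra (Qform n)) ^ m)

theorem hasLead_cliffParts (n : ℕ) (L : List (Fin n)) (m : ℕ) :
    HasLead (cliffDilation n (cliffParts n L m).1) (2 * m)
        (algebraMap (MvPolynomial (Fin n) ℂ) _
          ((L.map fun i => 1 + Polynomial.C (X i) * Polynomial.X).prod.coeff m)) ∧
      HasLead (cliffDilation n (cliffParts n L m).2) (2 * m) 0 := by
  induction L generalizing m with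
  | nil =>
    obtain _ | m := m
    · simpa [HasLead.zero] using HasLead.monomial 0 (1 : CliffordAlgebra (Qform n))
    · simp [altParts, HasLead.zero, Polynomial.coeff_one]
  | cons i L ih =>
    obtain _ | m := m
    · simpa [HasLead.zero, Polynomial.mul_coeff_zero, coeff_prod_map_one_add_zero] using
        HasLead.monomial 0 (1 : CliffordAlgebra (Qform n))
    · have hX := hasLead_cliffDilation_X n i
      have hι := hasLead_cliffDilation_ι_single n i
      have hs := hasLead_cliffDilation_neg_one_pow n m
      have hd : 2 + 2 * m = 2 * (m + 1) := by ring
      rw [coeff_prod_map_one_add_cons]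
      simp only [altParts, Algebra.smul_def, map_add, map_mul (cliffDilation n),
        map_mul (algebraMap (MvPolynomial (Fin n) ℂ) (CliffordAlgebra (Qform n)))]
      have h₁ := (ih (m + 1)).1.add (hd ▸ (hX.mul (ih m).1).add
        (zero_add (2 + 2 * m) ▸ hs.mul (hι.mul (ih m).2)))
      have h₂ := (ih (m + 1)).2.add (hd ▸ (hX.mul (ih m).2).add
        (zero_add (2 + 2 * m) ▸ hs.mul (hι.mul (ih m).1)))
      simp only [mul_zero, zero_mul, add_zero] at h₁ h₂
      exact ⟨h₁, h₂⟩

/-- The dilation multiplies the polynomial `p` by `t ^ (2 * d)`; that is, `p` is homogeneous of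
degree `d`. -/
def ScalesBy {n : ℕ} (d : ℕ) (p : MvPolynomial (Fin n) ℂ) : Prop :=
  dilation n p = Polynomial.C p * Polynomial.X ^ (2 * d)

lemma ScalesBy.mul {n d e : ℕ} {p q : MvPolynomial (Fin n) ℂ} (hp : ScalesBy d p)
    (hq : ScalesBy e q) : ScalesBy (d + e) (p * q) := by
  rw [ScalesBy] at *
  rw [map_mul, hp, hq, map_mul, mul_add, pow_add]
  ring

lemma ScalesBy.sum {n d : ℕ} {p : Fin n → MvPolynomial (Fin n) ℂ} (hp : ∀ i, ScalesBy d (p i)) :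
    ScalesBy d (∑ i, p i) := by
  simp only [ScalesBy] at *
  simp only [map_sum, Finset.sum_mul, hp]

lemma scalesBy_X {n : ℕ} (i : Fin n) : ScalesBy 1 (X i) := by simp [ScalesBy, dilation]

lemma scalesBy_Tmat {n : ℕ} (i j : Fin n) : ScalesBy 1 (Tmat n i j) := by
  rw [Tmat, of_apply]
  split_ifs
  · exact scalesBy_X j
  · rw [ScalesBy, map_neg, scalesBy_X, map_neg]
    ring
  · simp [ScalesBy]

lemma scalesBy_Tmat_pow_mulVec (n m : ℕ) (i : Fin n) :
    ScalesBy m ((Tmat n ^ m *ᵥ fun _ => 1) i) := by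
  induction m generalizing i with
  | zero => simp [ScalesBy]
  | succ m ih =>
    rw [pow_succ', ← mulVec_mulVec, add_comm]
    exact ScalesBy.sum fun j => (scalesBy_Tmat i j).mul (ih j)

lemma scalesBy_zeta (n m : ℕ) : ScalesBy (m + 1) (zeta n m) := by
  simp only [zeta, dotProduct, one_mul, mulVec_diagonal]
  rw [add_comm]
  exact ScalesBy.sum fun i => (scalesBy_X i).mul (scalesBy_Tmat_pow_mulVec n m i)

theorem hasLead_zel (n k : ℕ) :
    HasLead (cliffDilation n (zel n k)) (2 * (k + 1)) (algebraMap _ _ (leadPoly n k)) := by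
  by_cases hk : Even k
  · rw [zel_of_even hk, leadPoly, if_pos hk, cliffDilation_algebraMap, scalesBy_zeta,
      Polynomial.map_mul, Polynomial.map_C, Polynomial.map_pow, Polynomial.map_X]
    exact HasLead.monomial _ _
  · rw [zel_of_odd hk, leadPoly, if_neg hk]
    have h := (hasLead_cliffParts n (List.finRange n) (k + 1)).1
    rw [← Fin.prod_univ_def] at h
    have h' := coeff_prod_one_add_C_mul_X (σ := Fin n) (K := ℂ) 1 (k + 1)
    simp only [one_mul, one_pow] at h'
    rwa [h'] at h

end LeadingCoefficients

section Independence

lemma algebraMap_clifford_injective (n : ℕ) :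
    Function.Injective (algebraMap (MvPolynomial (Fin n) ℂ) (CliffordAlgebra (Qform n))) := by
  let : Invertible (2 : MvPolynomial (Fin n) ℂ) :=
    (Invertible.map (C (σ := Fin n)) (2 : ℂ)).copy 2 (map_ofNat C 2).symm
  refine Function.Injective.of_comp (f := CliffordAlgebra.equivExterior (Qform n)) ?_
  have h : ⇑(CliffordAlgebra.equivExterior (Qform n)) ∘ algebraMap _ _ =
      algebraMap (MvPolynomial (Fin n) ℂ) (ExteriorAlgebra _ (Fin n → MvPolynomial (Fin n) ℂ)) :=
    funext fun r =>
      CliffordAlgebra.changeForm_algebraMap CliffordAlgebra.changeForm.associated_neg_proof r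
  rw [h]
  exact (ExteriorAlgebra.algebraMap_leftInverse _).injective

open scoped IsMulCommutative in
/-- A family of pairwise commuting elements of an algebra defines a homomorphism from a polynomial
ring. -/
lemma exists_aeval_of_commute {σ K A : Type*} [CommRing K] [Ring A] [Algebra K A] (z : σ → A)
    (hz : ∀ a b, z a * z b = z b * z a) :
    ∃ F : MvPolynomial σ K →ₐ[K] A, ∀ k, F (X k) = z k := by
  have := Algebra.isMulCommutative_adjoin K (s := Set.range z) (by
    rintro _ ⟨a, rfl⟩ _ ⟨b, rfl⟩
    exact hz a b)
  refine ⟨(Algebra.adjoin K (Set.range z)).val.comp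
    (aeval fun k => ⟨z k, Algebra.subset_adjoin ⟨k, rfl⟩⟩), fun k => ?_⟩
  simp

lemma hasLead_monomial {n : ℕ} {F : MvPolynomial (Fin n) ℂ →ₐ[ℂ] CliffordAlgebra (Qform n)}
    (hF : ∀ k : Fin n, F (X k) = zel n k) (s : Fin n →₀ ℕ) (c : ℂ) :
    HasLead (cliffDilation n (F (monomial s c)))
      (Finsupp.weight (fun k : Fin n => 2 * ((k : ℕ) + 1)) s)
      (algebraMap _ _ (aeval (fun k : Fin n => leadPoly n k) (monomial s c))) := by
  have hC (c : ℂ) : HasLead (cliffDilation n (F (monomial 0 c))) 0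
      (algebraMap _ _ (aeval (fun k : Fin n => leadPoly n k) (monomial 0 c))) := by
    have h : F (C c) = algebraMap _ _ (C c : MvPolynomial (Fin n) ℂ) :=
      (F.commutes c).trans (IsScalarTower.algebraMap_apply ℂ (MvPolynomial (Fin n) ℂ) _ c)
    have h' : dilation n (C c) = Polynomial.C (C c) := (dilation n).commutes c
    rw [monomial_zero', h, cliffDilation_algebraMap, h', aeval_C, Polynomial.map_C]
    simpa using HasLead.monomial 0 (algebraMap (MvPolynomial (Fin n) ℂ)
      (CliffordAlgebra (Qform n)) (C c))
  have hmul {p q : MvPolynomial (Fin n) ℂ} {d e : ℕ}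
      (hp : HasLead (cliffDilation n (F p)) d
        (algebraMap _ _ (aeval (fun k : Fin n => leadPoly n k) p)))
      (hq : HasLead (cliffDilation n (F q)) e
        (algebraMap _ _ (aeval (fun k : Fin n => leadPoly n k) q))) :
      HasLead (cliffDilation n (F (p * q))) (d + e)
        (algebraMap _ _ (aeval (fun k : Fin n => leadPoly n k) (p * q))) := by
    simpa only [map_mul] using hp.mul hq
  induction s using Finsupp.induction_linear generalizing c with
  | zero => simpa only [map_zero] using hC c
  | add s t hs ht =>
    rw [← mul_one c, ← monomial_mul, map_add]
    exact hmul (hs c) (ht 1)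
  | single k e =>
    induction e with
    | zero => simpa only [Finsupp.single_zero, map_zero] using hC c
    | succ e ih =>
      rw [Finsupp.single_add, ← mul_one c, ← monomial_mul, map_add]
      refine hmul ih ?_
      change HasLead (cliffDilation n (F (X k))) _ (algebraMap _ _ (aeval _ (X k)))
      rw [hF, aeval_X, Finsupp.weight_single, one_smul]
      exact hasLead_zel n k

theorem injective_of_X_eq_zel {n : ℕ}
    {F : MvPolynomial (Fin n) ℂ →ₐ[ℂ] CliffordAlgebra (Qform n)}
    (hF : ∀ k : Fin n, F (X k) = zel n k) : Function.Injective F := by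
  rw [injective_iff_map_eq_zero]
  intro P hP
  by_contra hP0
  set w : Fin n → ℕ := fun k => 2 * ((k : ℕ) + 1)
  obtain ⟨s, hs, hmax⟩ := Finset.exists_max_image P.support (Finsupp.weight w)
    (Finset.nonempty_iff_ne_empty.2 (support_eq_empty.not.2 hP0))
  have hcoeff : (cliffDilation n (F P)).coeff (Finsupp.weight w s) =
      algebraMap _ _ (aeval (fun k : Fin n => leadPoly n k)
        (weightedHomogeneousComponent w (Finsupp.weight w s) P)) := by
    conv_lhs => rw [P.as_sum]
    rw [weightedHomogeneousComponent_apply, Finset.sum_filter]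
    simp only [map_sum, Polynomial.finsetSum_coeff]
    refine Finset.sum_congr rfl fun t ht => ?_
    have ht' := hasLead_monomial hF t (coeff t P)
    split_ifs with h
    · rw [← h]
      exact ht'.2
    · rw [map_zero, map_zero]
      exact (ht'.of_lt (lt_of_le_of_ne (hmax t ht) h)).2
  rw [hP, map_zero, Polynomial.coeff_zero, eq_comm,
    map_eq_zero_iff _ (algebraMap_clifford_injective n),
    map_eq_zero_iff _ (aeval_leadPoly_injective n)] at hcoeff
  have h := congrArg (coeff s) hcoeff
  rw [coeff_weightedHomogeneousComponent, if_pos rfl, coeff_zero] at h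
  exact mem_support_iff.1 hs h

end Independence

theorem zel_commute_and_algebraically_independent (n : ℕ) (hn : 0 < n) :
    (∀ a b : Fin n, zel n a * zel n b = zel n b * zel n a) ∧
      ∃ F : MvPolynomial (Fin n) ℂ →ₐ[ℂ] CliffordAlgebra (Qform n),
        Function.Injective F ∧ ∀ k : Fin n, F (X k) = zel n k := by
  have hcomm (a b : Fin n) : zel n a * zel n b = zel n b * zel n a := zel_commute n a b
  obtain ⟨F, hF⟩ := exists_aeval_of_commute (K := ℂ) (fun k : Fin n => zel n k) hcomm
  exact ⟨hcomm, F, injective_of_X_eq_zel hF, hF⟩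
end
end

section
/- With z_0, …, z_{n−1} ∈ Cl(Q) as defined (z_k = ζ_k·1 for even k, and for odd k the even ℤ/2ℤ-graded component of Σ_{1≤i_1<⋯<i_{k+1}≤n} (x_{i_1} + (−1)^{k} ξ_{i_1}) ⋯ (x_{i_k} − ξ_{i_k})(x_{i_{k+1}} + ξ_{i_{k+1}})), let W_0 be the unital ℂ-subalgebra of Cl(Q) generated by z_0,…,z_{n−1}. Then there exist m = 2^n · n! elements b_1, …, b_m ∈ Cl(Q) such that every element a ∈ Cl(Q) can be written uniquely as a = Σ_{j=1}^{m} b_j y_j with y_1, …, y_m ∈ W_0; that is, Cl(Q) is a free right W_0-module of rank 2^n · n!. -/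
open MvPolynomial Matrix

noncomputable section

/-- The subalgebra `W₀` of `Cl(Q)` generated by `z₀, …, z_{n−1}`. -/
def W0 (n : ℕ) : Subalgebra ℂ (CliffordAlgebra (Qform n)) :=
  Algebra.adjoin ℂ (Set.range fun k : Fin n => zel n k)

section StepRel
variable {K E : Type*} [CommRing K] [Ring E] [Algebra K E]

/-- The relations between the parts `A, B, C, D` at `t` and `a, b, c, d` at `s` of a generating
function that are preserved when one more generator is multiplied in. -/
structure StepRel (t s : K) (A B C D a b c d : E) : Prop where
  AA : A * a - a * A = 0
  CC : C * c - c * C = 0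
  AC_DD : s • (A * c) - s • (c * A) + t • (C * a) - t • (a * C) - (t * s) • (D * d) +
    (t * s) • (d * D) = 0
  AC_BB : t • (A * c) - t • (c * A) + s • (C * a) - s • (a * C) - (t * s) • (B * b) +
    (t * s) • (b * B) = 0
  AC_BD : t • (A * c) - t • (c * A) + s • (C * a) - s • (a * C) + t • (B * d) + t • (d * B) -
    s • (D * b) - s • (b * D) = 0
  AC_DB : s • (A * c) - s • (c * A) + t • (C * a) - t • (a * C) - s • (B * d) - s • (d * B) +
    t • (D * b) + t • (b * D) = 0
  AC_BD_DD : -(t * s ^ 2) • (A * c) - (t * s ^ 2) • (c * A) + (t ^ 2 * s) • (C * a) +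
    (t ^ 2 * s) • (a * C) + s ^ 2 • (D * d) - t ^ 2 • (D * d) + s ^ 2 • (d * D) - t ^ 2 • (d * D) -
    (t * s ^ 2) • (B * d) + (t * s ^ 2) • (d * B) - (t ^ 2 * s) • (D * b) +
    (t ^ 2 * s) • (b * D) = 0
  AC_BD_BB : (t ^ 2 * s) • (A * c) + (t ^ 2 * s) • (c * A) - (t * s ^ 2) • (C * a) -
    (t * s ^ 2) • (a * C) + s ^ 2 • (B * b) - t ^ 2 • (B * b) + s ^ 2 • (b * B) - t ^ 2 • (b * B) -
    (t ^ 2 * s) • (B * d) + (t ^ 2 * s) • (d * B) - (t * s ^ 2) • (D * b) +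
    (t * s ^ 2) • (b * D) = 0
  AD : s • (A * d) - s • (d * A) + t • (D * a) - t • (a * D) = 0
  CD : C * d - d * C + D * c - c * D = 0
  BC : t • (B * c) - t • (c * B) + s • (C * b) - s • (b * C) = 0
  AB : A * b - b * A + B * a - a * B = 0
  AB_AD : t ^ 2 • (A * b) - s ^ 2 • (A * b) - t ^ 2 • (b * A) + s ^ 2 • (b * A) +
    (t ^ 2 * s) • (A * d) + (t ^ 2 * s) • (d * A) - (t * s ^ 2) • (D * a) -
    (t * s ^ 2) • (a * D) = 0
  AD_AB : (t * s) • (B * a) + (t * s) • (a * B) - (t * s) • (A * b) - (t * s) • (b * A) -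
    t • (A * d) + t • (d * A) - s • (D * a) + s • (a * D) = 0
  CD_BC : t ^ 2 • (C * d) - s ^ 2 • (C * d) - t ^ 2 • (d * C) + s ^ 2 • (d * C) -
    (t * s ^ 2) • (B * c) - (t * s ^ 2) • (c * B) + (t ^ 2 * s) • (C * b) +
    (t ^ 2 * s) • (b * C) = 0
  BC_CD : s • (B * c) - s • (c * B) + t • (C * b) - t • (b * C) - (t * s) • (D * c) -
    (t * s) • (c * D) + (t * s) • (C * d) + (t * s) • (d * C) = 0

set_option linter.unusedSimpArgs false in
set_option maxHeartbeats 2000000 in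
theorem StepRel.step {x t s : K} {ξ A B C D a b c d : E} (h : StepRel t s A B C D a b c d)
    (hξ : ξ * ξ = algebraMap K E x)
    (hA : A * ξ = ξ * A) (hB : B * ξ = -(ξ * B)) (hC : C * ξ = ξ * C) (hD : D * ξ = -(ξ * D))
    (ha : a * ξ = ξ * a) (hb : b * ξ = -(ξ * b)) (hc : c * ξ = ξ * c) (hd : d * ξ = -(ξ * d)) :
    StepRel t s (A + t • (x • C - ξ * D)) (B + t • (x • D - ξ * C))
      (C + t • (x • A + ξ * B)) (D + t • (x • B + ξ * A))
      (a + s • (x • c - ξ * d)) (b + s • (x • d - ξ * c))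
      (c + s • (x • a + ξ * b)) (d + s • (x • b + ξ * a)) := by
  have hξ' (z : E) : ξ * (ξ * z) = x • z := by
    rw [← mul_assoc, hξ, Algebra.smul_def]
  have hA' (z : E) : A * (ξ * z) = ξ * (A * z) := by
    rw [← mul_assoc, hA, mul_assoc]
  have hB' (z : E) : B * (ξ * z) = -(ξ * (B * z)) := by
    rw [← mul_assoc, hB, neg_mul, mul_assoc]
  have hC' (z : E) : C * (ξ * z) = ξ * (C * z) := by
    rw [← mul_assoc, hC, mul_assoc]
  have hD' (z : E) : D * (ξ * z) = -(ξ * (D * z)) := by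
    rw [← mul_assoc, hD, neg_mul, mul_assoc]
  have ha' (z : E) : a * (ξ * z) = ξ * (a * z) := by
    rw [← mul_assoc, ha, mul_assoc]
  have hb' (z : E) : b * (ξ * z) = -(ξ * (b * z)) := by
    rw [← mul_assoc, hb, neg_mul, mul_assoc]
  have hc' (z : E) : c * (ξ * z) = ξ * (c * z) := by
    rw [← mul_assoc, hc, mul_assoc]
  have hd' (z : E) : d * (ξ * z) = -(ξ * (d * z)) := by
    rw [← mul_assoc, hd, neg_mul, mul_assoc]
  have x_AA := congrArg (ξ * ·) h.AA
  have x_CC := congrArg (ξ * ·) h.CC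
  have x_AC_DD := congrArg (ξ * ·) h.AC_DD
  have x_AC_BB := congrArg (ξ * ·) h.AC_BB
  have x_AC_BD := congrArg (ξ * ·) h.AC_BD
  have x_AC_DB := congrArg (ξ * ·) h.AC_DB
  have x_AC_BD_DD := congrArg (ξ * ·) h.AC_BD_DD
  have x_AC_BD_BB := congrArg (ξ * ·) h.AC_BD_BB
  have x_AD := congrArg (ξ * ·) h.AD
  have x_CD := congrArg (ξ * ·) h.CD
  have x_BC := congrArg (ξ * ·) h.BC
  have x_AB := congrArg (ξ * ·) h.AB
  have x_AB_AD := congrArg (ξ * ·) h.AB_AD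
  have x_AD_AB := congrArg (ξ * ·) h.AD_AB
  have x_CD_BC := congrArg (ξ * ·) h.CD_BC
  have x_BC_CD := congrArg (ξ * ·) h.BC_CD
  simp only [mul_add, mul_sub, mul_neg, mul_zero, mul_smul_comm] at x_AA x_CC x_AC_DD x_AC_BB x_AC_BD
  simp only [mul_add, mul_sub, mul_neg, mul_zero, mul_smul_comm] at x_AC_DB x_AC_BD_DD x_AC_BD_BB
  simp only [mul_add, mul_sub, mul_neg, mul_zero, mul_smul_comm] at x_AD x_CD x_BC x_AB
  simp only [mul_add, mul_sub, mul_neg, mul_zero, mul_smul_comm] at x_AB_AD x_AD_AB x_CD_BC x_BC_CD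
  constructor
  · simp only [mul_add, add_mul, mul_sub, sub_mul, smul_mul_assoc, mul_smul_comm, mul_assoc,
      hA', hB', hC', hD', ha', hb', hc', hd', hξ', mul_neg,
      smul_add, smul_sub, smul_neg, smul_smul]
    linear_combination (norm := module) h.AA
      + (-1 : K) • x_AD
      + x • h.AC_DD
      + (x * (-t * s)) • x_CD
      + (x ^ 2 * t * s) • h.CC
  · simp only [mul_add, add_mul, mul_sub, sub_mul, smul_mul_assoc, mul_smul_comm, mul_assoc,
      hA', hB', hC', hD', ha', hb', hc', hd', hξ', mul_neg,
      smul_add, smul_sub, smul_neg, smul_smul]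
    linear_combination (norm := module) h.CC
      + x_BC
      + x • h.AC_BB
      + (x * t * s) • x_AB
      + (x ^ 2 * t * s) • h.AA
  · simp only [mul_add, add_mul, mul_sub, sub_mul, smul_mul_assoc, mul_smul_comm, mul_assoc,
      hA', hB', hC', hD', ha', hb', hc', hd', hξ', mul_neg,
      smul_add, smul_sub, smul_neg, smul_smul]
    linear_combination (norm := module) h.AC_DD
      + (-1 : K) • x_AB_AD
      + (-t * s) • x_CD
      + (t ^ 2) • x_AB
      + (x * (s ^ 2 + t ^ 2 - t ^ 2 * s ^ 2)) • h.AA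
      + (x * 2 * t * s) • h.CC
      + (x * t * s) • x_AD_AB
      + (x * t * s) • x_BC
      + (x ^ 2 * t * s) • h.AC_BB
  · simp only [mul_add, add_mul, mul_sub, sub_mul, smul_mul_assoc, mul_smul_comm, mul_assoc,
      hA', hB', hC', hD', ha', hb', hc', hd', hξ', mul_neg,
      smul_add, smul_sub, smul_neg, smul_smul]
    linear_combination (norm := module) h.AC_BB
      + x_CD_BC
      + (-t ^ 2) • x_CD
      + (t * s) • x_AB
      + (x * 2 * t * s) • h.AA
      + (x * (s ^ 2 + t ^ 2 - t ^ 2 * s ^ 2)) • h.CC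
      + (x * (-t * s)) • x_AD
      + (x * t * s) • x_BC_CD
      + (x ^ 2 * t * s) • h.AC_DD
  · simp only [mul_add, add_mul, mul_sub, sub_mul, smul_mul_assoc, mul_smul_comm, mul_assoc,
      hA', hB', hC', hD', ha', hb', hc', hd', hξ', mul_neg,
      smul_add, smul_sub, smul_neg, smul_smul]
    linear_combination (norm := module) h.AC_BD
      + (-s ^ 2 - t ^ 2) • x_CD
      + (x * 2 * t * s) • h.AA
      + (x * (s ^ 2 + t ^ 2)) • h.CC
      + (-x) • h.AC_BD_DD
      + (x * (-2 * t * s)) • x_AD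
      + (x ^ 2 * t * s) • h.AC_DB
  · simp only [mul_add, add_mul, mul_sub, sub_mul, smul_mul_assoc, mul_smul_comm, mul_assoc,
      hA', hB', hC', hD', ha', hb', hc', hd', hξ', mul_neg,
      smul_add, smul_sub, smul_neg, smul_smul]
    linear_combination (norm := module) h.AC_DB
      + (s ^ 2 + t ^ 2) • x_AB
      + (x * (s ^ 2 + t ^ 2)) • h.AA
      + (x * 2 * t * s) • h.CC
      + (-x) • h.AC_BD_BB
      + (x * 2 * t * s) • x_BC
      + (x ^ 2 * t * s) • h.AC_BD
  · simp only [mul_add, add_mul, mul_sub, sub_mul, smul_mul_assoc, mul_smul_comm, mul_assoc,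
      hA', hB', hC', hD', ha', hb', hc', hd', hξ', mul_neg,
      smul_add, smul_sub, smul_neg, smul_smul]
    linear_combination (norm := module) h.AC_BD_DD
      + (2 * t * s) • x_AD
      + (t ^ 2 + s ^ 2) • x_AD_AB
      + (x * (t ^ 2 + s ^ 2)) • h.AC_BB
      + (x * 2 * t * s) • h.AC_DD
      + (x * (-2 * t * s)) • h.AC_DB
      + (x * (-s ^ 2 - t ^ 2 + t ^ 2 * s ^ 2)) • h.AC_BD
      + (x * (-2 * t * s)) • x_AB_AD
      + (x * (-t * s ^ 3 + t ^ 3 * s)) • x_AB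
      + (x ^ 2 * t * s) • h.AC_BD_BB
  · simp only [mul_add, add_mul, mul_sub, sub_mul, smul_mul_assoc, mul_smul_comm, mul_assoc,
      hA', hB', hC', hD', ha', hb', hc', hd', hξ', mul_neg,
      smul_add, smul_sub, smul_neg, smul_smul]
    linear_combination (norm := module) h.AC_BD_BB
      + (s ^ 2 + t ^ 2) • x_BC_CD
      + (-2 * t * s) • x_BC
      + (x * (-s ^ 2 - t ^ 2 + t ^ 2 * s ^ 2)) • h.AC_DB
      + (x * (s ^ 2 + t ^ 2)) • h.AC_DD
      + (x * (-2 * t * s)) • h.AC_BD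
      + (x * 2 * t * s) • h.AC_BB
      + (x * (t * s ^ 3 - t ^ 3 * s)) • x_CD
      + (x * 2 * t * s) • x_CD_BC
      + (x ^ 2 * t * s) • h.AC_BD_DD
  · simp only [mul_add, add_mul, mul_sub, sub_mul, smul_mul_assoc, mul_smul_comm, mul_assoc,
      hA', hB', hC', hD', ha', hb', hc', hd', hξ', mul_neg,
      smul_add, smul_sub, smul_neg, smul_smul]
    linear_combination (norm := module) h.AD
      + (s ^ 2 + t ^ 2) • x_AA
      + (-x) • h.AB_AD
      + (x * t * s) • h.CD
      + (x * t ^ 2) • h.AB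
      + (x * t * s) • x_AC_BD
      + (x ^ 2 * t * s) • h.BC
  · simp only [mul_add, add_mul, mul_sub, sub_mul, smul_mul_assoc, mul_smul_comm, mul_assoc,
      hA', hB', hC', hD', ha', hb', hc', hd', hξ', mul_neg,
      smul_add, smul_sub, smul_neg, smul_smul]
    linear_combination (norm := module) h.CD
      + x_AC_BD
      + x • h.BC
      + (-x) • h.AD_AB
      + (x * 2 * t * s) • x_AA
      + (x ^ 2 * t * s) • h.AB
  · simp only [mul_add, add_mul, mul_sub, sub_mul, smul_mul_assoc, mul_smul_comm, mul_assoc,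
      hA', hB', hC', hD', ha', hb', hc', hd', hξ', mul_neg,
      smul_add, smul_sub, smul_neg, smul_smul]
    linear_combination (norm := module) h.BC
      + (-s ^ 2 - t ^ 2) • x_CC
      + (-x) • h.CD_BC
      + (x * t ^ 2) • h.CD
      + (x * t * s) • h.AB
      + (x * (-t * s)) • x_AC_DB
      + (x ^ 2 * t * s) • h.AD
  · simp only [mul_add, add_mul, mul_sub, sub_mul, smul_mul_assoc, mul_smul_comm, mul_assoc,
      hA', hB', hC', hD', ha', hb', hc', hd', hξ', mul_neg,
      smul_add, smul_sub, smul_neg, smul_smul]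
    linear_combination (norm := module) h.AB
      + (-1 : K) • x_AC_DB
      + x • h.AD
      + x • h.BC_CD
      + (x * (-2 * t * s)) • x_CC
      + (x ^ 2 * t * s) • h.CD
  · simp only [mul_add, add_mul, mul_sub, sub_mul, smul_mul_assoc, mul_smul_comm, mul_assoc,
      hA', hB', hC', hD', ha', hb', hc', hd', hξ', mul_neg,
      smul_add, smul_sub, smul_neg, smul_smul]
    linear_combination (norm := module) h.AB_AD
      + (s ^ 2 + t ^ 2) • x_AC_DD
      + (-t ^ 2) • x_AC_DB
      + (-t * s) • x_AC_BD
      + (x * (-s ^ 2 + t ^ 2 * s ^ 2)) • h.AD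
      + (x * (-t * s)) • h.AD_AB
      + (x * t ^ 2) • h.BC_CD
      + (x * (-t * s)) • h.BC
      + (x * (t * s ^ 3 - t ^ 3 * s)) • x_CC
      + (x * t * s) • x_AC_BD_DD
      + (x ^ 2 * t * s) • h.CD_BC
  · simp only [mul_add, add_mul, mul_sub, sub_mul, smul_mul_assoc, mul_smul_comm, mul_assoc,
      hA', hB', hC', hD', ha', hb', hc', hd', hξ', mul_neg,
      smul_add, smul_sub, smul_neg, smul_smul]
    linear_combination (norm := module) h.AD_AB
      + (-2 * t * s) • x_AA
      + (-1 : K) • x_AC_BD_DD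
      + (-x) • h.CD_BC
      + (x * (-s ^ 2 + t ^ 2 * s ^ 2)) • h.CD
      + (x * (-t * s)) • h.AB
      + (x * (-2 * t * s)) • x_AC_DD
      + (x * t * s) • x_AC_DB
      + (x ^ 2 * (-t * s)) • h.BC_CD
  · simp only [mul_add, add_mul, mul_sub, sub_mul, smul_mul_assoc, mul_smul_comm, mul_assoc,
      hA', hB', hC', hD', ha', hb', hc', hd', hξ', mul_neg,
      smul_add, smul_sub, smul_neg, smul_smul]
    linear_combination (norm := module) h.CD_BC
      + (-s ^ 2 - t ^ 2) • x_AC_BB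
      + (t * s) • x_AC_DB
      + (t ^ 2) • x_AC_BD
      + (x * (-t * s)) • h.AD
      + (x * t * s) • h.BC_CD
      + (x * (-s ^ 2 + t ^ 2 * s ^ 2)) • h.BC
      + (x * (-t ^ 2)) • h.AD_AB
      + (x * (-t * s ^ 3 + t ^ 3 * s)) • x_AA
      + (x * (-t * s)) • x_AC_BD_BB
      + (x ^ 2 * t * s) • h.AB_AD
  · simp only [mul_add, add_mul, mul_sub, sub_mul, smul_mul_assoc, mul_smul_comm, mul_assoc,
      hA', hB', hC', hD', ha', hb', hc', hd', hξ', mul_neg,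
      smul_add, smul_sub, smul_neg, smul_smul]
    linear_combination (norm := module) h.BC_CD
      + (-2 * t * s) • x_CC
      + (-1 : K) • x_AC_BD_BB
      + x • h.AB_AD
      + (x * t * s) • h.CD
      + (x * (s ^ 2 - t ^ 2 * s ^ 2)) • h.AB
      + (x * (-2 * t * s)) • x_AC_BB
      + (x * t * s) • x_AC_BD
      + (x ^ 2 * (-t * s)) • h.AD_AB

end StepRel

/-- The generator `ξᵢ` of the Clifford algebra. -/
def xi {n : ℕ} (i : Fin n) : CliffordAlgebra (Qform n) :=
  CliffordAlgebra.ι (Qform n) (Pi.single i 1)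

lemma xi_mul_self {n : ℕ} (i : Fin n) :
    xi i * xi i = algebraMap (MvPolynomial (Fin n) ℂ) (CliffordAlgebra (Qform n)) (X i) := by
  rw [xi, CliffordAlgebra.ι_sq_scalar]
  congr 1
  rw [Qform, QuadraticMap.weightedSumSquares_apply, Finset.sum_eq_single i] <;> simp +contextual

lemma xi_mul_xi {n : ℕ} {i j : Fin n} (h : i ≠ j) : xi i * xi j = -(xi j * xi i) := by
  rw [eq_neg_iff_add_eq_zero, xi, xi, CliffordAlgebra.ι_mul_ι_add_swap]
  refine (congrArg _ ?_).trans (map_zero _)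
  rw [QuadraticMap.polar, Qform]
  simp only [QuadraticMap.weightedSumSquares_apply, ← Finset.sum_sub_distrib]
  refine Finset.sum_eq_zero fun k _ => ?_
  rcases eq_or_ne k i with rfl | hk <;> simp [*]

/-- The product of the `ξᵢ` over a finite set of indices, in increasing order. -/
def xiProd {n : ℕ} (s : Finset (Fin n)) : CliffordAlgebra (Qform n) :=
  ((s.sort (· ≤ ·)).map xi).prod

@[simp]
lemma xiProd_empty {n : ℕ} : xiProd (∅ : Finset (Fin n)) = 1 := by simp [xiProd]

lemma xiProd_insert {n : ℕ} {a : Fin n} {s : Finset (Fin n)} (h : ∀ b ∈ s, a < b) :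
    xiProd (insert a s) = xi a * xiProd s := by
  rw [xiProd, Finset.sort_insert (· ≤ ·) (fun b hb => (h b hb).le) (fun ha => lt_irrefl _ (h a ha))]
  simp [xiProd]

lemma exists_xi_mul_xiProd {n : ℕ} (i : Fin n) (s : Finset (Fin n)) :
    ∃ (ε : ℂ) (t : Finset (Fin n)) (m : Fin n →₀ ℕ), t ⊆ insert i s ∧
      t.card + 2 * m.degree = s.card + 1 ∧
      xi i * xiProd s = ε • (monomial m (1 : ℂ)) • xiProd t := by
  induction s using Finset.induction_on_min with
  | empty => exact ⟨1, {i}, 0, by simp, by simp, by simp [xiProd]⟩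
  | insert a s ha ih =>
    have ha' : a ∉ s := fun h => lt_irrefl _ (ha a h)
    rcases lt_trichotomy i a with h | rfl | h
    · refine ⟨1, insert i (insert a s), 0, le_rfl, ?_, ?_⟩
      · rw [Finset.card_insert_of_notMem]
        · simp
        · rw [Finset.mem_insert, not_or]
          exact ⟨h.ne, fun hi => lt_asymm h (ha i hi)⟩
      · rw [xiProd_insert (a := i)]
        · simp
        · intro b hb
          rcases Finset.mem_insert.1 hb with rfl | hb
          · exact h
          · exact h.trans (ha b hb)
    · refine ⟨1, s, Finsupp.single i 1, ?_, ?_, ?_⟩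
      · exact (Finset.subset_insert _ _).trans (Finset.subset_insert _ _)
      · rw [Finset.card_insert_of_notMem ha', Finsupp.degree_single]
      · rw [xiProd_insert ha, ← mul_assoc, xi_mul_self, one_smul, Algebra.smul_def]
        rfl
    · obtain ⟨ε, t, m, ht, hd, he⟩ := ih
      have hat : ∀ b ∈ t, a < b := by
        intro b hb
        rcases Finset.mem_insert.1 (ht hb) with rfl | hb
        · exact h
        · exact ha b hb
      refine ⟨-ε, insert a t, m, ?_, ?_, ?_⟩
      · rw [Finset.insert_comm]
        exact Finset.insert_subset_insert _ ht
      · rw [Finset.card_insert_of_notMem ha',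
          Finset.card_insert_of_notMem fun h => lt_irrefl _ (hat a h)]
        omega
      · rw [xiProd_insert ha, xiProd_insert hat, ← mul_assoc, xi_mul_xi h.ne', neg_mul, mul_assoc,
          he, mul_smul_comm, mul_smul_comm, neg_smul]

lemma exists_prod_map_xi {n : ℕ} (l : List (Fin n)) :
    ∃ (ε : ℂ) (t : Finset (Fin n)) (m : Fin n →₀ ℕ), t.card + 2 * m.degree = l.length ∧
      (l.map xi).prod = ε • (monomial m (1 : ℂ)) • xiProd t := by
  induction l with
  | nil => exact ⟨1, ∅, 0, by simp, by simp⟩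
  | cons i l ih =>
    obtain ⟨ε, t, m, hd, he⟩ := ih
    obtain ⟨δ, u, k, -, hd', he'⟩ := exists_xi_mul_xiProd i t
    refine ⟨ε * δ, u, m + k, ?_, ?_⟩
    · rw [map_add, List.length_cons]
      omega
    · rw [List.map_cons, List.prod_cons, he, mul_smul_comm, mul_smul_comm, he', mul_smul,
        smul_comm _ δ, smul_smul (monomial m 1), monomial_mul, one_mul]

lemma span_range_xiProd (n : ℕ) :
    Submodule.span (MvPolynomial (Fin n) ℂ) (Set.range (xiProd (n := n))) = ⊤ := by
  refine Submodule.eq_top_iff'.2 fun y => ?_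
  induction y using CliffordAlgebra.left_induction with
  | algebraMap r =>
    rw [Algebra.algebraMap_eq_smul_one]
    exact Submodule.smul_mem _ _ (Submodule.subset_span ⟨∅, xiProd_empty⟩)
  | add x y hx hy => exact Submodule.add_mem _ hx hy
  | ι_mul y v hy =>
    have hv : CliffordAlgebra.ι (Qform n) v = ∑ i, v i • xi i := by
      conv_lhs => rw [pi_eq_sum_univ' v]
      simp [xi, map_sum]
    rw [hv, Finset.sum_mul]
    refine Submodule.sum_mem _ fun i _ => ?_
    rw [smul_mul_assoc]
    refine Submodule.smul_mem _ _ ?_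
    clear hv
    induction hy using Submodule.span_induction with
    | mem z hz =>
      obtain ⟨s, rfl⟩ := hz
      obtain ⟨ε, t, m, -, -, he⟩ := exists_xi_mul_xiProd i s
      rw [he, ← algebraMap_smul (MvPolynomial (Fin n) ℂ) ε]
      exact Submodule.smul_mem _ _ (Submodule.smul_mem _ _ (Submodule.subset_span ⟨t, rfl⟩))
    | zero => simp
    | add x y _ _ hx hy =>
      rw [mul_add]
      exact Submodule.add_mem _ hx hy
    | smul r x _ hx =>
      rw [mul_smul_comm]
      exact Submodule.smul_mem _ _ hx

lemma finrank_cliffordAlgebra (n : ℕ) :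
    Module.finrank (MvPolynomial (Fin n) ℂ) (CliffordAlgebra (Qform n)) = 2 ^ n := by
  have : Invertible (2 : MvPolynomial (Fin n) ℂ) :=
    (Invertible.map (C : ℂ →+* MvPolynomial (Fin n) ℂ) 2).copy _ (map_ofNat _ 2).symm
  rw [(CliffordAlgebra.equivExterior (Qform n)).finrank_eq,
    Module.finrank_eq_card_basis (Pi.basisFun (MvPolynomial (Fin n) ℂ) (Fin n)).ExteriorAlgebra]
  simp

/-- The products `xiProd s` form a basis of the Clifford algebra over the polynomial ring. -/
def xiBasis (n : ℕ) :
    Module.Basis (Finset (Fin n)) (MvPolynomial (Fin n) ℂ) (CliffordAlgebra (Qform n)) :=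
  .mk (v := xiProd)
    (linearIndependent_of_top_le_span_of_card_eq_finrank (span_range_xiProd n).ge
      (by rw [finrank_cliffordAlgebra]; simp))
    (span_range_xiProd n).ge

/-- The elements `x ^ m • ξ_s` form a basis of the Clifford algebra over `ℂ`. -/
def monomialBasis (n : ℕ) :
    Module.Basis ((Fin n →₀ ℕ) × Finset (Fin n)) ℂ (CliffordAlgebra (Qform n)) :=
  (basisMonomials (Fin n) ℂ).smulTower (xiBasis n)

lemma monomialBasis_apply {n : ℕ} (p : (Fin n →₀ ℕ) × Finset (Fin n)) :
    monomialBasis n p = monomial p.1 (1 : ℂ) • xiProd p.2 := by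
  simp [monomialBasis, xiBasis, Module.Basis.smulTower_apply]

/-- The `ℂ`-span of the words of length less than `d` in the generators `ξᵢ`. -/
def wordSpan (n d : ℕ) : Submodule ℂ (CliffordAlgebra (Qform n)) :=
  Submodule.span ℂ {y | ∃ l : List (Fin n), l.length < d ∧ (l.map xi).prod = y}

lemma wordSpan_mono (n : ℕ) : Monotone (wordSpan n) := fun _ _ h =>
  Submodule.span_mono fun _ ⟨l, hl, hy⟩ => ⟨l, hl.trans_le h, hy⟩

lemma mul_mem_wordSpan_of_forall {n a b d : ℕ} (h : ∀ i j, i < a → j < b → i + j < d)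
    {y z : CliffordAlgebra (Qform n)} (hy : y ∈ wordSpan n a) (hz : z ∈ wordSpan n b) :
    y * z ∈ wordSpan n d := by
  have hyz := Submodule.mul_mem_mul hy hz
  rw [wordSpan, wordSpan, Submodule.span_mul_span] at hyz
  refine Submodule.span_le.2 ?_ hyz
  rintro _ ⟨_, ⟨l, hl, rfl⟩, _, ⟨k, hk, rfl⟩, rfl⟩
  exact Submodule.subset_span ⟨l ++ k, by simpa using h _ _ hl hk, by simp⟩

lemma xi_mem_wordSpan {n : ℕ} (i : Fin n) : xi i ∈ wordSpan n 2 :=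
  Submodule.subset_span ⟨[i], by simp, by simp⟩

lemma one_mem_wordSpan (n : ℕ) : 1 ∈ wordSpan n 1 :=
  Submodule.subset_span ⟨[], by simp, by simp⟩

lemma algebraMap_X_mem_wordSpan {n : ℕ} (i : Fin n) :
    algebraMap (MvPolynomial (Fin n) ℂ) (CliffordAlgebra (Qform n)) (X i) ∈ wordSpan n 3 := by
  rw [← xi_mul_self]
  exact mul_mem_wordSpan_of_forall (by omega) (xi_mem_wordSpan i) (xi_mem_wordSpan i)

lemma xiProd_mem_wordSpan {n : ℕ} (s : Finset (Fin n)) : xiProd s ∈ wordSpan n (s.card + 1) :=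
  Submodule.subset_span ⟨s.sort (· ≤ ·), by simp, rfl⟩

lemma algebraMap_monomial_mem_wordSpan {n : ℕ} (m : Fin n →₀ ℕ) :
    algebraMap (MvPolynomial (Fin n) ℂ) (CliffordAlgebra (Qform n)) (monomial m 1) ∈
      wordSpan n (2 * m.degree + 1) := by
  induction m using Finsupp.induction_linear with
  | zero => simpa [← C_apply] using one_mem_wordSpan n
  | add f g hf hg =>
    rw [← one_mul (1 : ℂ), ← monomial_mul, map_mul, map_add]
    exact mul_mem_wordSpan_of_forall (by omega) hf hg
  | single i k =>
    rw [Finsupp.degree_single]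
    induction k with
    | zero => simpa [← C_apply] using one_mem_wordSpan n
    | succ k ih =>
      rw [Finsupp.single_add, ← one_mul (1 : ℂ), ← monomial_mul, map_mul]
      exact mul_mem_wordSpan_of_forall (by omega) ih (algebraMap_X_mem_wordSpan i)

lemma algebraMap_mem_wordSpan {n d : ℕ} {f : MvPolynomial (Fin n) ℂ} (hf : f.IsHomogeneous d) :
    algebraMap (MvPolynomial (Fin n) ℂ) (CliffordAlgebra (Qform n)) f ∈
      wordSpan n (2 * d + 1) := by
  rw [f.as_sum, map_sum]
  refine Submodule.sum_mem _ fun m hm => ?_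
  have hd : m.degree = d := by
    simpa [Finsupp.weight_apply, Finsupp.degree_eq_sum, Finsupp.sum_fintype] using
      hf (mem_support_iff.1 hm)
  have hc : monomial m (coeff m f) = coeff m f • monomial m (1 : ℂ) := by simp [smul_monomial]
  rw [hc, ← hd, Algebra.algebraMap_eq_smul_one, smul_assoc, ← Algebra.algebraMap_eq_smul_one]
  exact Submodule.smul_mem _ _ (algebraMap_monomial_mem_wordSpan m)

lemma wordSpan_le (n d : ℕ) :
    wordSpan n d ≤
      Submodule.span ℂ (monomialBasis n '' {p | p.2.card + 2 * p.1.degree < d}) := by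
  refine Submodule.span_le.2 ?_
  rintro _ ⟨l, hl, rfl⟩
  obtain ⟨ε, t, m, hd, he⟩ := exists_prod_map_xi l
  rw [he, ← monomialBasis_apply (m, t)]
  exact Submodule.smul_mem _ _ (Submodule.subset_span ⟨(m, t), by simpa [hd] using hl, rfl⟩)

lemma monomialBasis_mem_wordSpan {n : ℕ} (p : (Fin n →₀ ℕ) × Finset (Fin n)) :
    monomialBasis n p ∈ wordSpan n (p.2.card + 2 * p.1.degree + 1) := by
  rw [monomialBasis_apply, Algebra.smul_def]
  exact mul_mem_wordSpan_of_forall (by omega) (algebraMap_monomial_mem_wordSpan p.1)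
    (xiProd_mem_wordSpan p.2)

lemma cliffFactors_insert {n m : ℕ} {a : Fin n} {s : Finset (Fin n)} (h : ∀ b ∈ s, a < b) :
    cliffFactors n (m + 1) (insert a s) =
      ((X a : MvPolynomial (Fin n) ℂ) • 1 + (-1 : MvPolynomial (Fin n) ℂ) ^ m • xi a) *
        cliffFactors n m s := by
  rw [cliffFactors, Finset.sort_insert (· ≤ ·) (fun b hb => (h b hb).le)
    (fun ha => lt_irrefl _ (h a ha)), List.mapIdx_cons, List.prod_cons, cliffFactors]
  have (t : ℕ) : m + 1 - 1 - (t + 1) = m - 1 - t := by omega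
  simp only [this]
  simp only [xi, Algebra.algebraMap_eq_smul_one, add_tsub_cancel_right, tsub_zero]

/-- The sum of `cliffFactors n m s` over the subsets `s` of `U` of size `m`. -/
def cliffSum {n : ℕ} (U : Finset (Fin n)) (m : ℕ) : CliffordAlgebra (Qform n) :=
  ∑ s ∈ U.powersetCard m, cliffFactors n m s

lemma cliffSum_eq_zero {n m : ℕ} {U : Finset (Fin n)} (h : U.card < m) : cliffSum U m = 0 := by
  simp [cliffSum, Finset.powersetCard_eq_empty.2 h]

@[simp]
lemma cliffSum_zero {n : ℕ} (U : Finset (Fin n)) : cliffSum U 0 = 1 := by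
  simp [cliffSum, cliffFactors]

@[simp]
lemma cliffSum_empty_succ (n m : ℕ) : cliffSum (∅ : Finset (Fin n)) (m + 1) = 0 :=
  cliffSum_eq_zero (by simp)

lemma cliffSum_insert {n : ℕ} {a : Fin n} {U : Finset (Fin n)} (h : ∀ b ∈ U, a < b) (m : ℕ) :
    cliffSum (insert a U) (m + 1) = cliffSum U (m + 1) + ((X a : MvPolynomial (Fin n) ℂ) •
      cliffSum U m + (-1 : MvPolynomial (Fin n) ℂ) ^ m • (xi a * cliffSum U m)) := by
  have ha : a ∉ U := fun ha => lt_irrefl _ (h a ha)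
  have hs {s : Finset (Fin n)} (hs : s ∈ U.powersetCard m) : s ⊆ U :=
    (Finset.mem_powersetCard.1 hs).1
  rw [cliffSum, Finset.powersetCard_succ_insert ha, Finset.sum_union, Finset.sum_image]
  · congr 1
    rw [← smul_mul_assoc, ← one_mul (cliffSum U m), ← smul_mul_assoc, one_mul, ← add_mul, cliffSum,
      Finset.mul_sum]
    exact Finset.sum_congr rfl fun s hs' => cliffFactors_insert fun b hb => h b (hs hs' hb)
  · intro s hs' t ht' hst
    rw [← Finset.erase_insert fun h => ha (hs hs' h), hst,
      Finset.erase_insert fun h => ha (hs ht' h)]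
  · refine Finset.disjoint_left.2 fun s hs' ht => ?_
    obtain ⟨t, -, rfl⟩ := Finset.mem_image.1 ht
    exact ha ((Finset.mem_powersetCard.1 hs').1 (Finset.mem_insert_self a t))

/-- The projection onto a component of the `ℤ/2ℤ`-grading of the Clifford algebra. -/
def gradeProj (n : ℕ) (i : ZMod 2) :
    CliffordAlgebra (Qform n) →ₗ[MvPolynomial (Fin n) ℂ] CliffordAlgebra (Qform n) :=
  GradedAlgebra.proj (CliffordAlgebra.evenOdd (Qform n)) i

lemma gradeProj_xi_mul {n : ℕ} (i : ZMod 2) (a : Fin n) (y : CliffordAlgebra (Qform n)) :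
    gradeProj n (1 + i) (xi a * y) = xi a * gradeProj n i y := by
  rw [gradeProj, gradeProj, GradedAlgebra.proj_apply, GradedAlgebra.proj_apply]
  exact DirectSum.coe_decompose_mul_add_of_left_mem _ (CliffordAlgebra.ι_mem_evenOdd_one _ _)

lemma gradeProj_zero_one (n : ℕ) : gradeProj n 0 1 = 1 := by
  rw [gradeProj, GradedAlgebra.proj_apply]
  exact DirectSum.decompose_of_mem_same _ SetLike.GradedOne.one_mem

lemma gradeProj_one_one (n : ℕ) : gradeProj n 1 1 = 0 := by
  rw [gradeProj, GradedAlgebra.proj_apply]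
  exact DirectSum.decompose_of_mem_ne _ SetLike.GradedOne.one_mem zero_ne_one

lemma gradeProj_zero_xi_mul {n : ℕ} (a : Fin n) (y : CliffordAlgebra (Qform n)) :
    gradeProj n 0 (xi a * y) = xi a * gradeProj n 1 y :=
  gradeProj_xi_mul 1 a y

lemma gradeProj_one_xi_mul {n : ℕ} (a : Fin n) (y : CliffordAlgebra (Qform n)) :
    gradeProj n 1 (xi a * y) = xi a * gradeProj n 0 y :=
  gradeProj_xi_mul 0 a y

lemma gradeProj_cliffSum_mul_xi {n : ℕ} {U : Finset (Fin n)} {k : Fin n} (hk : k ∉ U) (m : ℕ) :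
    gradeProj n 0 (cliffSum U m) * xi k = xi k * gradeProj n 0 (cliffSum U m) ∧
      gradeProj n 1 (cliffSum U m) * xi k = -(xi k * gradeProj n 1 (cliffSum U m)) := by
  induction U using Finset.induction_on_min generalizing m with
  | empty =>
    cases m with
    | zero => simp [gradeProj_zero_one, gradeProj_one_one]
    | succ m => simp
  | insert a U ha ih =>
    cases m with
    | zero => simp [gradeProj_zero_one, gradeProj_one_one]
    | succ m =>
      rw [Finset.mem_insert, not_or] at hk
      obtain ⟨h1, h2⟩ := ih hk.2 (m + 1)
      obtain ⟨h3, h4⟩ := ih hk.2 m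
      simp only [cliffSum_insert ha, map_add, map_smul, gradeProj_zero_xi_mul,
        gradeProj_one_xi_mul, add_mul, mul_add, smul_mul_assoc, mul_smul_comm, h1, h2, h3,
        mul_assoc, h4, mul_neg, neg_add, smul_neg, ← mul_assoc (xi k) (xi a), xi_mul_xi hk.1,
        neg_mul, neg_neg, and_self]

/-- The terms of parity `j` of the sequence of `i`-th graded components of `cliffSum U m`. -/
def cliffPart {n : ℕ} (U : Finset (Fin n)) (i j : ZMod 2) (m : ℕ) : CliffordAlgebra (Qform n) :=
  if (m : ZMod 2) = j then gradeProj n i (cliffSum U m) else 0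

/-- The generating polynomial of `cliffPart U i j`, evaluated at `t`. -/
def cliffGen {n : ℕ} (U : Finset (Fin n)) (i j : ZMod 2) (t : MvPolynomial (Fin n) ℂ) :
    CliffordAlgebra (Qform n) :=
  ∑ m ∈ Finset.range (n + 2), t ^ m • cliffPart U i j m

lemma neg_one_pow_of_cast_zmod_two {K : Type*} [Ring K] {m : ℕ} :
    ((m : ZMod 2) = 0 → (-1 : K) ^ m = 1) ∧ ((m : ZMod 2) = 1 → (-1 : K) ^ m = -1) :=
  ⟨fun h => (ZMod.natCast_eq_zero_iff_even.1 h).neg_one_pow,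
    fun h => (ZMod.natCast_eq_one_iff_odd.1 h).neg_one_pow⟩

lemma sum_range_smul_shift {K E : Type*} [CommRing K] [AddCommGroup E] [Module K E] {N : ℕ}
    {f g h : ℕ → E} (h0 : f 0 = g 0) (hs : ∀ m, f (m + 1) = g (m + 1) + h m) (hN : h N = 0)
    (t : K) :
    ∑ m ∈ Finset.range (N + 1), t ^ m • f m =
      ∑ m ∈ Finset.range (N + 1), t ^ m • g m + t • ∑ m ∈ Finset.range (N + 1), t ^ m • h m := by
  rw [Finset.sum_range_succ', Finset.sum_range_succ' (fun m => t ^ m • g m),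
    Finset.sum_range_succ (fun m => t ^ m • h m)]
  simp only [hs, h0, hN, smul_add, smul_zero, add_zero, Finset.sum_add_distrib, Finset.smul_sum,
    smul_smul, pow_succ']
  abel

lemma cliffGen_insert {n : ℕ} {a : Fin n} {U : Finset (Fin n)} (h : ∀ b ∈ U, a < b)
    {i i' j j' : ZMod 2} (hi : 1 + i' = i) (hj : j' + 1 = j) {σ : MvPolynomial (Fin n) ℂ}
    (hσ : ∀ m : ℕ, (m : ZMod 2) = j' → (-1) ^ m = σ) (t : MvPolynomial (Fin n) ℂ) :
    cliffGen (insert a U) i j t = cliffGen U i j t + t • ((X a : MvPolynomial (Fin n) ℂ) •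
      cliffGen U i j' t + σ • (xi a * cliffGen U i' j' t)) := by
  subst hi hj
  have hU : cliffSum U (n + 1) = 0 :=
    cliffSum_eq_zero (by simpa using (Finset.card_le_univ U).trans_lt (Nat.lt_succ_self _))
  rw [cliffGen, sum_range_smul_shift (g := cliffPart U (1 + i') (j' + 1))
    (h := fun m => (X a : MvPolynomial (Fin n) ℂ) • cliffPart U (1 + i') j' m +
      σ • (xi a * cliffPart U i' j' m))]
  · simp only [cliffGen, smul_add, Finset.sum_add_distrib, Finset.smul_sum, Finset.mul_sum,
      smul_comm _ σ, mul_smul_comm, smul_comm _ (X a : MvPolynomial (Fin n) ℂ)]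
  · simp [cliffPart]
  · intro m
    by_cases hm : (m : ZMod 2) = j'
    · simp [cliffPart, hm, cliffSum_insert h, gradeProj_xi_mul, hσ m hm]
    · simp [cliffPart, hm]
  · simp [cliffPart, hU]

lemma cliffGen_empty (n : ℕ) (t : MvPolynomial (Fin n) ℂ) (i j : ZMod 2) :
    cliffGen ∅ i j t = if i = 0 ∧ j = 0 then 1 else 0 := by
  rw [cliffGen, Finset.sum_range_succ', Finset.sum_eq_zero]
  · have h (i : ZMod 2) : i = 0 ∨ i = 1 := by
      revert i
      decide
    rcases h i with rfl | rfl <;> rcases h j with rfl | rfl <;>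
      simp [cliffPart, gradeProj_zero_one, gradeProj_one_one]
  · intro m _
    simp [cliffPart]

lemma cliffGen_mul_xi {n : ℕ} {U : Finset (Fin n)} {k : Fin n} (hk : k ∉ U) (j : ZMod 2)
    (t : MvPolynomial (Fin n) ℂ) :
    cliffGen U 0 j t * xi k = xi k * cliffGen U 0 j t ∧
      cliffGen U 1 j t * xi k = -(xi k * cliffGen U 1 j t) := by
  simp only [cliffGen, Finset.sum_mul, Finset.mul_sum, ← Finset.sum_neg_distrib]
  constructor <;> refine Finset.sum_congr rfl fun m _ => ?_ <;>
    by_cases hm : (m : ZMod 2) = j <;>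
    simp [cliffPart, hm, gradeProj_cliffSum_mul_xi hk m]

lemma stepRel_cliffGen {n : ℕ} (U : Finset (Fin n)) (t s : MvPolynomial (Fin n) ℂ) :
    StepRel t s (cliffGen U 0 0 t) (cliffGen U 1 0 t) (cliffGen U 0 1 t) (cliffGen U 1 1 t)
      (cliffGen U 0 0 s) (cliffGen U 1 0 s) (cliffGen U 0 1 s) (cliffGen U 1 1 s) := by
  induction U using Finset.induction_on_min with
  | empty => constructor <;> simp [cliffGen_empty]
  | insert a U ha ih =>
    have ha' : a ∉ U := fun h => lt_irrefl _ (ha a h)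
    have h0 (m : ℕ) := (neg_one_pow_of_cast_zmod_two (K := MvPolynomial (Fin n) ℂ) (m := m)).1
    have h1 (m : ℕ) := (neg_one_pow_of_cast_zmod_two (K := MvPolynomial (Fin n) ℂ) (m := m)).2
    have hstep := ih.step (xi_mul_self a)
      (cliffGen_mul_xi ha' 0 t).1 (cliffGen_mul_xi ha' 0 t).2 (cliffGen_mul_xi ha' 1 t).1
      (cliffGen_mul_xi ha' 1 t).2 (cliffGen_mul_xi ha' 0 s).1 (cliffGen_mul_xi ha' 0 s).2
      (cliffGen_mul_xi ha' 1 s).1 (cliffGen_mul_xi ha' 1 s).2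
    have e00 (t) := cliffGen_insert ha (i := 0) (i' := 1) (j := 0) (j' := 1) rfl rfl h1 t
    have e10 (t) := cliffGen_insert ha (i := 1) (i' := 0) (j := 0) (j' := 1) rfl rfl h1 t
    have e01 (t) := cliffGen_insert ha (i := 0) (i' := 1) (j := 1) (j' := 0) rfl rfl h0 t
    have e11 (t) := cliffGen_insert ha (i := 1) (i' := 0) (j := 1) (j' := 0) rfl rfl h0 t
    simp only [neg_smul, one_smul, ← sub_eq_add_neg] at e00 e10 e01 e11
    rw [e00, e10, e01, e11, e00, e10, e01, e11]
    exact hstep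

lemma eq_zero_of_forall_sum_smul_eq_zero {k V : Type*} [Field k] [Infinite k] [AddCommGroup V]
    [Module k V] {N : ℕ} {v : ℕ → V} (h : ∀ t : k, ∑ i ∈ Finset.range N, t ^ i • v i = 0) {i : ℕ}
    (hi : i < N) : v i = 0 := by
  refine (Module.forall_dual_apply_eq_zero_iff k (v i)).1 fun φ => ?_
  have hp : ∑ i ∈ Finset.range N, Polynomial.monomial i (φ (v i)) = 0 := by
    refine Polynomial.funext fun t => ?_
    have := congrArg φ (h t)
    simpa [Polynomial.eval_finsetSum, mul_comm] using this
  have := congrArg (Polynomial.coeff · i) hp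
  simpa [Polynomial.finsetSum_coeff, Polynomial.coeff_monomial, hi] using this

lemma commute_cliffPart {n i j : ℕ} (U : Finset (Fin n)) (hi : i < n + 2) (hj : j < n + 2) :
    Commute (cliffPart U 0 0 i) (cliffPart U 0 0 j) := by
  have key (t s : ℂ) : ∑ i ∈ Finset.range (n + 2), t ^ i • ∑ j ∈ Finset.range (n + 2), s ^ j •
      (cliffPart U 0 0 i * cliffPart U 0 0 j - cliffPart U 0 0 j * cliffPart U 0 0 i) = 0 := by
    have h := (stepRel_cliffGen U (C t) (C s)).AA
    have hC (t : ℂ) : cliffGen U 0 0 (C t) =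
        ∑ i ∈ Finset.range (n + 2), t ^ i • cliffPart U 0 0 i := by
      refine Finset.sum_congr rfl fun i _ => ?_
      rw [← C_pow]
      exact algebraMap_smul _ _ _
    rw [hC, hC, Finset.sum_mul_sum, Finset.sum_mul_sum] at h
    rw [← h]
    simp only [smul_sub, Finset.sum_sub_distrib, Finset.smul_sum]
    congr 1
    · simp only [smul_mul_smul_comm, mul_smul]
    · rw [Finset.sum_comm]
      simp only [smul_mul_smul_comm, mul_smul, smul_comm (t ^ _)]
  exact sub_eq_zero.1 (eq_zero_of_forall_sum_smul_eq_zero (fun s =>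
    eq_zero_of_forall_sum_smul_eq_zero (fun t => key t s) hi) hj)

lemma commute_zel {n i j : ℕ} (hi : i < n) (hj : j < n) : Commute (zel n i) (zel n j) := by
  have hc (k : ℕ) (hk : ¬ Even k) : zel n k = cliffPart Finset.univ 0 0 (k + 1) := by
    rw [zel, if_neg hk, cliffPart, if_pos]
    · rfl
    · exact ZMod.natCast_eq_zero_iff_even.2 (Nat.even_add_one.2 hk)
  by_cases hi' : Even i
  · rw [zel, if_pos hi']
    exact Algebra.commutes _ _
  by_cases hj' : Even j
  · rw [zel.eq_def n j, if_pos hj']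
    exact (Algebra.commutes _ _).symm
  rw [hc i hi', hc j hj']
  exact commute_cliffPart _ (by omega) (by omega)

/-- The leading term of `zel n k` for the word length filtration. -/
def leadZel (n k : ℕ) : MvPolynomial (Fin n) ℂ :=
  if Even k then zeta n k else esymm (Fin n) ℂ (k + 1)

lemma isHomogeneous_zeta (n k : ℕ) : (zeta n k).IsHomogeneous (k + 1) := by
  have h (i : Fin n) : ((Tmat n ^ k).mulVec (fun _ => 1) i).IsHomogeneous k := by
    induction k generalizing i with
    | zero => simpa using isHomogeneous_one (Fin n) ℂ
    | succ k ih =>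
      rw [pow_succ', ← mulVec_mulVec, mulVec, dotProduct]
      refine IsHomogeneous.sum _ _ _ fun j _ => ?_
      rw [add_comm]
      refine IsHomogeneous.mul ?_ (ih j)
      simp only [Tmat, of_apply]
      split_ifs
      · exact isHomogeneous_X _ _
      · exact (isHomogeneous_X _ _).neg
      · exact isHomogeneous_zero _ _ _
  rw [zeta, dotProduct]
  refine IsHomogeneous.sum _ _ _ fun i _ => ?_
  rw [one_mul, mulVec_diagonal, add_comm]
  exact (isHomogeneous_X _ _).mul (h i)

lemma isHomogeneous_leadZel (n k : ℕ) : (leadZel n k).IsHomogeneous (k + 1) := by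
  rw [leadZel]
  split_ifs
  · exact isHomogeneous_zeta n k
  · rw [esymm]
    refine IsHomogeneous.sum _ _ _ fun s hs => ?_
    rw [← (Finset.mem_powersetCard.1 hs).2, Finset.card_eq_sum_ones]
    exact IsHomogeneous.prod _ _ _ fun i _ => isHomogeneous_X _ _

lemma cliffFactors_sub_mem_wordSpan {n : ℕ} (s : Finset (Fin n)) :
    cliffFactors n s.card s - algebraMap (MvPolynomial (Fin n) ℂ) (CliffordAlgebra (Qform n))
      (∏ i ∈ s, X i) ∈ wordSpan n (2 * s.card) := by
  induction s using Finset.induction_on_min with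
  | empty => simp [cliffFactors]
  | insert a s ha ih =>
    have ha' : a ∉ s := fun h => lt_irrefl _ (ha a h)
    rw [Finset.card_insert_of_notMem ha', cliffFactors_insert ha, Finset.prod_insert ha', map_mul]
    have hp := algebraMap_mem_wordSpan
      (IsHomogeneous.prod s (fun i => (X i : MvPolynomial (Fin n) ℂ)) _
        fun i _ => isHomogeneous_X ℂ i)
    rw [Finset.sum_const, smul_eq_mul, mul_one] at hp
    have hc := Submodule.add_mem _ (wordSpan_mono n (by omega) ih) hp
    rw [sub_add_cancel] at hc
    have h1 := mul_mem_wordSpan_of_forall (d := 2 * (s.card + 1)) (by omega)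
      (algebraMap_X_mem_wordSpan a) ih
    have h2 := mul_mem_wordSpan_of_forall (d := 2 * (s.card + 1)) (by omega)
      (xi_mem_wordSpan a) hc
    rw [← Algebra.algebraMap_eq_smul_one, add_mul, add_sub_right_comm, ← mul_sub]
    refine Submodule.add_mem _ h1 ?_
    rcases neg_one_pow_eq_or (MvPolynomial (Fin n) ℂ) s.card with h | h <;> rw [h]
    · simpa using h2
    · simpa using h2

lemma gradeProj_mem_wordSpan {n d : ℕ} (i : ZMod 2) {y : CliffordAlgebra (Qform n)}
    (hy : y ∈ wordSpan n d) : gradeProj n i y ∈ wordSpan n d := by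
  have hw (l : List (Fin n)) : gradeProj n i (l.map xi).prod = (l.map xi).prod ∨
      gradeProj n i (l.map xi).prod = 0 := by
    induction l generalizing i with
    | nil =>
      have h : i = 0 ∨ i = 1 := by
        revert i
        decide
      rcases h with rfl | rfl
      · exact .inl (gradeProj_zero_one n)
      · exact .inr (gradeProj_one_one n)
    | cons a l ih =>
      rw [List.map_cons, List.prod_cons, ← add_sub_cancel 1 i, gradeProj_xi_mul]
      rcases ih (i - 1) with h | h <;> simp [h]
  induction hy using Submodule.span_induction with
  | mem y hy =>
    obtain ⟨l, hl, rfl⟩ := hy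
    rcases hw l with h | h <;> rw [h]
    · exact Submodule.subset_span ⟨l, hl, rfl⟩
    · exact Submodule.zero_mem _
  | zero => simp
  | add x y _ _ hx hy => simpa using Submodule.add_mem _ hx hy
  | smul c x _ hx =>
    rw [LinearMap.map_smul_of_tower]
    exact Submodule.smul_mem _ _ hx

lemma zel_sub_mem_wordSpan (n k : ℕ) :
    zel n k - algebraMap (MvPolynomial (Fin n) ℂ) (CliffordAlgebra (Qform n)) (leadZel n k) ∈
      wordSpan n (2 * (k + 1)) := by
  rw [zel, leadZel]
  split_ifs
  · simp
  · change gradeProj n 0 (cliffSum Finset.univ (k + 1)) - _ ∈ _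
    have h1 (r : MvPolynomial (Fin n) ℂ) :
        gradeProj n 0 (algebraMap (MvPolynomial (Fin n) ℂ) (CliffordAlgebra (Qform n)) r) =
          algebraMap (MvPolynomial (Fin n) ℂ) (CliffordAlgebra (Qform n)) r := by
      rw [Algebra.algebraMap_eq_smul_one, map_smul, gradeProj_zero_one]
    rw [← h1, ← map_sub, cliffSum, esymm, map_sum, ← Finset.sum_sub_distrib]
    refine gradeProj_mem_wordSpan 0 (Submodule.sum_mem _ fun s hs => ?_)
    have := cliffFactors_sub_mem_wordSpan s
    rwa [(Finset.mem_powersetCard.1 hs).2] at this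

lemma coeff_prod_one_add_C_mul_X_s19 {R σ : Type*} [CommRing R] (s : Finset σ)
    (f : σ → R) (k : ℕ) :
    PowerSeries.coeff k (∏ i ∈ s, (1 + PowerSeries.C (f i) * PowerSeries.X)) =
      ∑ t ∈ s.powersetCard k, ∏ i ∈ t, f i := by
  classical
  rw [Finset.prod_one_add, map_sum, Finset.powersetCard_eq_filter, Finset.sum_filter]
  refine Finset.sum_congr rfl fun t _ => ?_
  rw [Finset.prod_mul_distrib, Finset.prod_const, ← map_prod, PowerSeries.coeff_C_mul,
    PowerSeries.coeff_X_pow]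
  simp [eq_comm]

/-- The matrix `1 - t T` over the power series in `t`. -/
def resolventMatrix (n : ℕ) :
    Matrix (Fin n) (Fin n) (PowerSeries (MvPolynomial (Fin n) ℂ)) :=
  of fun i j => (if i = j then 1 else 0) - PowerSeries.C (Tmat n i j) * PowerSeries.X

/-- The vector of power series with coefficients `T ^ m v`. -/
def resolventVector (n : ℕ) (i : Fin n) : PowerSeries (MvPolynomial (Fin n) ℂ) :=
  .mk fun m => (Tmat n ^ m).mulVec (fun _ => 1) i

lemma resolventMatrix_mulVec (n : ℕ) : (resolventMatrix n).mulVec (resolventVector n) = 1 := by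
  funext i
  refine PowerSeries.ext fun m => ?_
  simp only [mulVec, dotProduct, resolventMatrix, of_apply, sub_mul, ite_mul, one_mul, zero_mul,
    Finset.sum_sub_distrib, Finset.sum_ite_eq, Finset.mem_univ, if_true, map_sub, map_sum,
    mul_assoc, PowerSeries.coeff_C_mul, resolventVector, PowerSeries.coeff_mk, Pi.one_apply]
  cases m with
  | zero => simp [Matrix.one_apply]
  | succ m =>
    simp only [PowerSeries.coeff_succ_X_mul, PowerSeries.coeff_mk, PowerSeries.coeff_one,
      Nat.succ_ne_zero, if_false, sub_eq_zero, mul_one]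
    simpa [mulVec, dotProduct, pow_succ'] using
      congrFun (mulVec_mulVec (fun _ => 1) (Tmat n) (Tmat n ^ m)).symm i

lemma det_add_of_mulVec_eq_one {S m : Type*} [CommRing S] [Fintype m] [DecidableEq m]
    {M : Matrix m m S} {w : m → S} (h : M.mulVec w = 1) (u : m → S) :
    (of fun i j => M i j + u j).det = M.det * (1 + u ⬝ᵥ w) := by
  have hM : (of fun i j => M i j + u j) =
      M * (1 + replicateCol Unit w * replicateRow Unit u) := by
    rw [mul_add, mul_one, ← Matrix.mul_assoc, ← replicateCol_mulVec, h]
    ext i j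
    simp [Matrix.mul_apply]
  rw [hM, det_mul, det_one_add_replicateCol_mul_replicateRow]

lemma det_resolventMatrix_mul (n : ℕ) (ε : MvPolynomial (Fin n) ℂ) :
    (of fun i j => resolventMatrix n i j +
      PowerSeries.C (ε * X j : MvPolynomial (Fin n) ℂ) * PowerSeries.X).det =
      (resolventMatrix n).det * (1 + PowerSeries.C ε * PowerSeries.X * .mk (zeta n)) := by
  have hz : PowerSeries.mk (zeta n) =
      ∑ j, PowerSeries.C (X j : MvPolynomial (Fin n) ℂ) * resolventVector n j := by
    refine PowerSeries.ext fun m => ?_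
    simp [zeta, dotProduct, mulVec_diagonal, resolventVector]
  rw [det_add_of_mulVec_eq_one (resolventMatrix_mulVec n)
    (fun j => PowerSeries.C (ε * X j : MvPolynomial (Fin n) ℂ) * PowerSeries.X), hz, dotProduct,
    Finset.mul_sum]
  refine congrArg (fun y => (resolventMatrix n).det * (1 + y))
    (Finset.sum_congr rfl fun j _ => ?_)
  rw [map_mul]
  ring

lemma coeff_det_resolventMatrix_mul (n : ℕ) (ε : MvPolynomial (Fin n) ℂ) (hε : ε = 1 ∨ ε = -1)
    (k : ℕ) : PowerSeries.coeff k ((resolventMatrix n).det *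
      (1 + PowerSeries.C ε * PowerSeries.X * .mk (zeta n))) = ε ^ k * esymm (Fin n) ℂ k := by
  have h : (of fun i j => resolventMatrix n i j +
      PowerSeries.C (ε * X j : MvPolynomial (Fin n) ℂ) * PowerSeries.X).det =
      ∏ i, (1 + PowerSeries.C (ε * X i : MvPolynomial (Fin n) ℂ) * PowerSeries.X) := by
    rcases hε with rfl | rfl
    · rw [det_of_isLowerTriangular]
      · refine Finset.prod_congr rfl fun i _ => ?_
        simp [resolventMatrix, Tmat]
      · intro i j hij
        have hij' : i < j := hij
        simp [resolventMatrix, Tmat, hij', hij'.ne]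
    · rw [det_of_isUpperTriangular]
      · refine Finset.prod_congr rfl fun i _ => ?_
        simp [resolventMatrix, Tmat]
      · intro i j hij
        have hij' : j < i := hij
        simp [resolventMatrix, Tmat, hij', hij'.ne', hij'.not_gt]
  rw [← det_resolventMatrix_mul, h, coeff_prod_one_add_C_mul_X_s19, esymm, Finset.mul_sum]
  refine Finset.sum_congr rfl fun s hs => ?_
  rw [Finset.prod_mul_distrib, Finset.prod_const, (Finset.mem_powersetCard.1 hs).2]

lemma coeff_det_resolventMatrix (n k : ℕ) : PowerSeries.coeff k (resolventMatrix n).det =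
    if Even k then esymm (Fin n) ℂ k else 0 := by
  have h1 := coeff_det_resolventMatrix_mul n 1 (.inl rfl) k
  have h2 := coeff_det_resolventMatrix_mul n (-1) (.inr rfl) k
  have h3 := congrArg₂ (· + ·) h1 h2
  simp only [← map_add, ← mul_add, ← add_mul] at h3
  have h4 : (1 : PowerSeries (MvPolynomial (Fin n) ℂ)) +
      PowerSeries.C (1 : MvPolynomial (Fin n) ℂ) * PowerSeries.X * .mk (zeta n) +
      (1 + PowerSeries.C (-1 : MvPolynomial (Fin n) ℂ) * PowerSeries.X * .mk (zeta n)) = 2 := by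
    rw [map_neg, map_one]
    ring
  rw [h4, mul_two, map_add, one_pow, ← mul_two] at h3
  refine mul_right_cancel₀ (two_ne_zero' (MvPolynomial (Fin n) ℂ)) (h3.trans ?_)
  split_ifs with hk
  · rw [hk.neg_one_pow]
    ring
  · rw [(Nat.not_even_iff_odd.1 hk).neg_one_pow]
    ring

lemma esymm_succ_eq_sum_zeta_mul {n k : ℕ} (hk : Even k) : esymm (Fin n) ℂ (k + 1) =
    ∑ p ∈ Finset.HasAntidiagonal.antidiagonal k,
      (if Even p.1 then esymm (Fin n) ℂ p.1 else 0) * zeta n p.2 := by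
  have h1 := coeff_det_resolventMatrix_mul n 1 (.inl rfl) (k + 1)
  rw [map_one, one_mul, mul_add, mul_one, map_add, coeff_det_resolventMatrix,
    if_neg (Nat.not_even_iff_odd.2 hk.add_one), zero_add, mul_left_comm,
    PowerSeries.coeff_succ_X_mul, PowerSeries.coeff_mul, one_pow, one_mul] at h1
  rw [← h1]
  simp only [coeff_det_resolventMatrix, PowerSeries.coeff_mk]

lemma esymm_mem_adjoin_leadZel {n k : ℕ} (hk : k ≤ n) :
    esymm (Fin n) ℂ k ∈ Algebra.adjoin ℂ (Set.range fun i : Fin n => leadZel n i) := by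
  induction k using Nat.strong_induction_on with
  | _ k ih =>
    cases k with
    | zero => simp
    | succ k =>
      by_cases hk' : Even k
      · rw [esymm_succ_eq_sum_zeta_mul hk']
        refine Subalgebra.sum_mem _ fun p hp => ?_
        rw [Finset.HasAntidiagonal.mem_antidiagonal] at hp
        split_ifs with hp'
        · refine Subalgebra.mul_mem _ (ih _ (by omega) (by omega)) ?_
          refine Algebra.subset_adjoin ⟨⟨p.2, by omega⟩, ?_⟩
          have : Even p.2 := by
            rw [← hp, Nat.even_add] at hk'
            exact hk'.1 hp'
          simp [leadZel, this]
        · simp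
      · exact Algebra.subset_adjoin ⟨⟨k, by omega⟩, by simp [leadZel, hk']⟩

section StaircaseSpan

variable {k A : Type*} [CommRing k] [CommRing A] [Algebra k A]

lemma pow_mem_mul_span_pow_of_monic {B : Subalgebra k A} {p : Polynomial A} (hp : p.Monic)
    (hB : ∀ i, p.coeff i ∈ B) {x : A} (hx : p.IsRoot x) (N : ℕ) :
    x ^ N ∈ Subalgebra.toSubmodule B * Submodule.span k {y | ∃ a < p.natDegree, y = x ^ a} := by
  induction N using Nat.strong_induction_on with
  | _ N ih =>
    rcases lt_or_ge N p.natDegree with hN | hN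
    · rw [← one_mul (x ^ N)]
      exact Submodule.mul_mem_mul B.one_mem (Submodule.subset_span ⟨N, hN, rfl⟩)
    · have h : x ^ N = -∑ i ∈ Finset.range p.natDegree,
          p.coeff i * x ^ (N - p.natDegree + i) := by
        have he := hx
        rw [Polynomial.IsRoot, Polynomial.eval_eq_sum_range, Finset.sum_range_succ,
          hp.coeff_natDegree, one_mul] at he
        simp only [pow_add, mul_left_comm _ (x ^ (N - p.natDegree)), ← Finset.mul_sum]
        rw [← mul_neg, ← eq_neg_of_add_eq_zero_right he, ← pow_add, Nat.sub_add_cancel hN]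
      rw [h]
      refine Submodule.neg_mem _ (Submodule.sum_mem _ fun i hi => ?_)
      have hi' := Finset.mem_range.1 hi
      have := Submodule.mul_mem_mul (show p.coeff i ∈ Subalgebra.toSubmodule B from hB i)
        (ih (N - p.natDegree + i) (by omega))
      rwa [← mul_assoc, B.isIdempotentElem_toSubmodule.eq] at this

lemma adjoin_insert_le_mul_span_pow {B : Subalgebra k A} {p : Polynomial A} (hp : p.Monic)
    (hB : ∀ i, p.coeff i ∈ B) {x : A} (hx : p.IsRoot x) (hd : 0 < p.natDegree) :
    Subalgebra.toSubmodule (Algebra.adjoin k ((B : Set A) ∪ {x})) ≤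
      Subalgebra.toSubmodule B * Submodule.span k {y | ∃ a < p.natDegree, y = x ^ a} := by
  have hpow := pow_mem_mul_span_pow_of_monic hp hB hx
  have hBV : Subalgebra.toSubmodule B ≤
      Subalgebra.toSubmodule B * Submodule.span k {y | ∃ a < p.natDegree, y = x ^ a} := by
    intro b hb
    rw [← mul_one b]
    exact Submodule.mul_mem_mul hb (Submodule.subset_span ⟨0, hd, (pow_zero x).symm⟩)
  intro y hy
  induction hy using Algebra.adjoin_induction with
  | mem y hy =>
    rcases hy with hy | rfl
    · exact hBV hy
    · simpa using hpow 1
  | algebraMap r => exact hBV (B.algebraMap_mem r)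
  | add y z _ _ hy hz => exact Submodule.add_mem _ hy hz
  | mul y z _ _ hy hz =>
    have h := Submodule.mul_mem_mul hy hz
    rw [mul_mul_mul_comm, B.isIdempotentElem_toSubmodule.eq] at h
    have hle : Submodule.span k {y | ∃ a < p.natDegree, y = x ^ a} *
        Submodule.span k {y | ∃ a < p.natDegree, y = x ^ a} ≤
        Subalgebra.toSubmodule B * Submodule.span k {y | ∃ a < p.natDegree, y = x ^ a} := by
      rw [Submodule.span_mul_span]
      refine Submodule.span_le.2 ?_
      rintro _ ⟨_, ⟨a, -, rfl⟩, _, ⟨b, -, rfl⟩, rfl⟩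
      have hab := hpow (a + b)
      rwa [pow_add] at hab
    have h' := mul_le_mul' (le_refl (Subalgebra.toSubmodule B)) hle h
    rwa [← mul_assoc, B.isIdempotentElem_toSubmodule.eq] at h'

/-- If the elementary symmetric functions of `x₀, …, x_{m-1}` lie in a subalgebra `B`, the algebra
generated by `B` and the `xᵢ` is spanned over `B` by the monomials below the staircase. -/
lemma adjoin_union_range_le_mul_span {m : ℕ} (B : Subalgebra k A) (x : Fin m → A)
    (hB : ∀ j, (∏ i, (Polynomial.X - Polynomial.C (x i))).coeff j ∈ B) :
    Subalgebra.toSubmodule (Algebra.adjoin k ((B : Set A) ∪ Set.range x)) ≤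
      Subalgebra.toSubmodule B *
        Submodule.span k {y | ∃ a : ∀ i : Fin m, Fin (m - i), y = ∏ i, x i ^ (a i : ℕ)} := by
  nontriviality A
  induction m generalizing B with
  | zero =>
    intro y hy
    simp only [Set.range_eq_empty, Set.union_empty, Algebra.adjoin_eq] at hy
    rw [← mul_one y]
    exact Submodule.mul_mem_mul hy (Submodule.subset_span ⟨isEmptyElim, by simp⟩)
  | succ m ih =>
    set p := ∏ i, (Polynomial.X - Polynomial.C (x i)) with hp
    set q := ∏ i : Fin m, (Polynomial.X - Polynomial.C (x i.succ)) with hq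
    have hpq : p = (Polynomial.X - Polynomial.C (x 0)) * q := Fin.prod_univ_succ _
    have hmonic : p.Monic := Polynomial.monic_prod_X_sub_C _ _
    have hroot : p.IsRoot (x 0) := by simp [hpq]
    have hdeg : p.natDegree = m + 1 := by
      rw [hp, Polynomial.natDegree_finsetProd_X_sub_C_eq_card, Finset.card_univ, Fintype.card_fin]
    set B' := Algebra.adjoin k ((B : Set A) ∪ {x 0}) with hB'
    have hBB' : B ≤ B' := fun b hb => Algebra.subset_adjoin (.inl hb)
    have hx0 : x 0 ∈ B' := Algebra.subset_adjoin (.inr rfl)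
    have hqB (j : ℕ) : ∀ i, q.natDegree < i + j → q.coeff i ∈ B' := by
      induction j with
      | zero =>
        intro i hi
        rw [Polynomial.coeff_eq_zero_of_natDegree_lt (by omega)]
        exact B'.zero_mem
      | succ j ihj =>
        intro i hi
        have h := congrArg (Polynomial.coeff · (i + 1)) hpq
        simp only [sub_mul, Polynomial.coeff_sub, Polynomial.coeff_X_mul,
          Polynomial.coeff_C_mul] at h
        rw [sub_eq_iff_eq_add.1 h.symm]
        exact B'.add_mem (hBB' (hB _)) (B'.mul_mem hx0 (ihj _ (by omega)))
    have h1 := ih B' (fun i => x i.succ) fun i => hqB (q.natDegree + 1) i (by omega)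
    have h2 := adjoin_insert_le_mul_span_pow hmonic hB hroot (by omega)
    have h3 : Algebra.adjoin k ((B : Set A) ∪ Set.range x) ≤
        Algebra.adjoin k ((B' : Set A) ∪ Set.range fun i : Fin m => x i.succ) := by
      refine Algebra.adjoin_le ?_
      rintro y (hy | ⟨i, rfl⟩)
      · exact Algebra.subset_adjoin (.inl (hBB' hy))
      · induction i using Fin.cases with
        | zero => exact Algebra.subset_adjoin (.inl hx0)
        | succ i => exact Algebra.subset_adjoin (.inr ⟨i, rfl⟩)
    refine (show Subalgebra.toSubmodule _ ≤ _ from h3).trans (h1.trans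
      ((mul_le_mul' h2 le_rfl).trans ?_))
    rw [mul_assoc, Submodule.span_mul_span]
    refine mul_le_mul' le_rfl (Submodule.span_mono ?_)
    rintro _ ⟨_, ⟨a, ha, rfl⟩, _, ⟨b, rfl⟩, rfl⟩
    refine ⟨Fin.cons ⟨a, by simpa [hdeg] using ha⟩ fun i => ⟨b i, by simp⟩, ?_⟩
    rw [Fin.prod_univ_succ]
    rfl

end StaircaseSpan

/-- The exponents of the monomials below the staircase. -/
abbrev StaircaseExp (n : ℕ) : Type := ∀ i : Fin n, Fin (n - i)

/-- The staircase monomial with exponent `a`. -/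
def staircaseMonomial {n : ℕ} (a : StaircaseExp n) : MvPolynomial (Fin n) ℂ :=
  ∏ i, X i ^ (a i : ℕ)

/-- The product of the leading terms `leadZel n k` with exponents `α`. -/
def leadMonomial {n : ℕ} (α : Fin n →₀ ℕ) : MvPolynomial (Fin n) ℂ :=
  ∏ k : Fin n, leadZel n k ^ α k

/-- The degree of the product of a staircase monomial and a monomial in the leading terms. -/
def staircaseDegree {n : ℕ} (p : StaircaseExp n × (Fin n →₀ ℕ)) : ℕ :=
  ∑ i, (p.1 i : ℕ) + ∑ k : Fin n, (k + 1) * p.2 k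

lemma isHomogeneous_leadMonomial {n : ℕ} (α : Fin n →₀ ℕ) :
    (leadMonomial α).IsHomogeneous (∑ k : Fin n, (k + 1) * α k) :=
  IsHomogeneous.prod _ _ _ fun k _ => (isHomogeneous_leadZel n k).pow _

lemma isHomogeneous_staircaseMonomial {n : ℕ} (a : StaircaseExp n) :
    (staircaseMonomial a).IsHomogeneous (∑ i, (a i : ℕ)) :=
  IsHomogeneous.prod _ _ _ fun _ _ => isHomogeneous_X_pow _ _

lemma span_range_staircase (n : ℕ) :
    Submodule.span ℂ (Set.range fun p : StaircaseExp n × (Fin n →₀ ℕ) =>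
      staircaseMonomial p.1 * leadMonomial p.2) = ⊤ := by
  set B := Algebra.adjoin ℂ (Set.range fun i : Fin n => leadZel n i) with hB
  have h := adjoin_union_range_le_mul_span B (X : Fin n → MvPolynomial (Fin n) ℂ) fun j => by
    rcases lt_or_ge n j with hj | hj
    · rw [Polynomial.coeff_eq_zero_of_natDegree_lt]
      · exact B.zero_mem
      · simpa [Polynomial.natDegree_finsetProd_X_sub_C_eq_card] using hj
    · have hc : (Finset.univ : Finset (Fin n)).card = n := by simp
      simp only [sub_eq_add_neg, ← map_neg]
      rw [Finset.prod_X_add_C_coeff _ _ (by rwa [hc]), hc]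
      have he : ∑ t ∈ Finset.univ.powersetCard (n - j), ∏ i ∈ t, -X i =
          (-1) ^ (n - j) * esymm (Fin n) ℂ (n - j) := by
        rw [esymm, Finset.mul_sum]
        refine Finset.sum_congr rfl fun t ht => ?_
        rw [Finset.prod_neg, (Finset.mem_powersetCard.1 ht).2]
      rw [he]
      exact B.mul_mem (B.pow_mem (B.neg_mem B.one_mem) _) (esymm_mem_adjoin_leadZel (by omega))
  have hBspan : Subalgebra.toSubmodule B ≤ Submodule.span ℂ (Set.range (leadMonomial (n := n))) := by
    intro y hy
    rw [Subalgebra.mem_toSubmodule, hB, Algebra.adjoin_range_eq_range_aeval] at hy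
    obtain ⟨g, rfl⟩ := hy
    change aeval _ g ∈ _
    rw [aeval_def, eval₂_eq']
    refine Submodule.sum_mem _ fun α _ => ?_
    rw [← Algebra.smul_def]
    exact Submodule.smul_mem _ _ (Submodule.subset_span ⟨α, rfl⟩)
  have htop : Algebra.adjoin ℂ ((B : Set (MvPolynomial (Fin n) ℂ)) ∪ Set.range X) = ⊤ :=
    top_unique ((adjoin_range_X (R := ℂ) (σ := Fin n)).ge.trans
      (Algebra.adjoin_mono Set.subset_union_right))
  rw [htop, Algebra.top_toSubmodule] at h
  refine top_unique (h.trans ((mul_le_mul' hBspan le_rfl).trans ?_))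
  rw [Submodule.span_mul_span]
  refine Submodule.span_mono ?_
  rintro _ ⟨_, ⟨α, rfl⟩, _, ⟨a, rfl⟩, rfl⟩
  exact ⟨(a, α), mul_comm _ _⟩

lemma mem_span_staircase_of_isHomogeneous {n d : ℕ} {f : MvPolynomial (Fin n) ℂ}
    (hf : f.IsHomogeneous d) :
    f ∈ Submodule.span ℂ ((fun p : StaircaseExp n × (Fin n →₀ ℕ) =>
      staircaseMonomial p.1 * leadMonomial p.2) '' {p | staircaseDegree p = d}) := by
  have h : f ∈ Submodule.span ℂ _ := span_range_staircase n ▸ Submodule.mem_top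
  have h' := Submodule.mem_map_of_mem (f := homogeneousComponent d) h
  rw [Submodule.map_span, homogeneousComponent_of_mem hf, if_pos rfl] at h'
  refine Submodule.span_le.2 ?_ h'
  rintro _ ⟨_, ⟨p, rfl⟩, rfl⟩
  have hp : (staircaseMonomial p.1 * leadMonomial p.2).IsHomogeneous (staircaseDegree p) :=
    (isHomogeneous_staircaseMonomial p.1).mul (isHomogeneous_leadMonomial p.2)
  rw [homogeneousComponent_of_mem hp]
  split_ifs with hd
  · exact Submodule.subset_span ⟨p, hd.symm, rfl⟩
  · exact Submodule.zero_mem _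

/-- A family indexed compatibly with the degrees of a basis, which spans each filtration step from
that basis, is itself a basis when the filtration steps are finite dimensional. -/
lemma linearIndependent_and_span_of_degree {K V ι κ : Type*} [Field K] [AddCommGroup V] [Module K V]
    (b : Module.Basis ι K V) (v : κ → V) (e : κ ≃ ι) (deg : ι → ℕ)
    (hfin : ∀ d, {i | deg i < d}.Finite)
    (h : ∀ i, b i ∈ Submodule.span K (v '' {j | deg (e j) < deg i + 1})) :
    LinearIndependent K v ∧ ⊤ ≤ Submodule.span K (Set.range v) := by
  constructor
  · rw [← linearIndependent_equiv e.symm, linearIndependent_iff_finset_linearIndependent]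
    intro s
    set d := s.sup deg + 1 with hd
    have hs : (s : Set ι) ⊆ {i | deg i < d} := fun i hi =>
      Nat.lt_succ_of_le (Finset.le_sup (f := deg) hi)
    refine LinearIndepOn.mono (s := {i | deg i < d}) ?_ hs
    have := (hfin d).fintype
    have hb : LinearIndependent K fun i : {i | deg i < d} => b i :=
      b.linearIndependent.comp _ Subtype.val_injective
    refine linearIndependent_iff_card_le_finrank_span.2 ?_
    rw [← finrank_span_eq_card hb, Set.finrank]
    have : FiniteDimensional K (Submodule.span K (Set.range
        fun i : {i | deg i < d} => (v ∘ e.symm) i)) :=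
      FiniteDimensional.span_of_finite K (Set.finite_range _)
    refine Submodule.finrank_mono (Submodule.span_le.2 ?_)
    rintro _ ⟨⟨i, hi⟩, rfl⟩
    refine Submodule.span_mono ?_ (h i)
    rintro _ ⟨j, hj, rfl⟩
    have hi' : deg i < d := hi
    have hj' : deg (e j) < deg i + 1 := hj
    exact ⟨⟨e j, show deg (e j) < d by omega⟩, by simp⟩
  · rw [← b.span_eq]
    refine Submodule.span_le.2 ?_
    rintro _ ⟨i, rfl⟩
    exact Submodule.span_mono (Set.image_subset_range _ _) (h i)

/-- The digits of the exponents in the radices `n - i`, as a degree-preserving bijection. -/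
def staircaseEquiv (n : ℕ) : StaircaseExp n × (Fin n →₀ ℕ) ≃ (Fin n →₀ ℕ) where
  toFun p := Finsupp.equivFunOnFinite.symm fun i => p.1 i + (n - i) * p.2 i.rev
  invFun β := (fun i => ⟨β i % (n - i), Nat.mod_lt _ (by omega)⟩,
    Finsupp.equivFunOnFinite.symm fun k => β k.rev / (n - k.rev))
  left_inv p := by
    obtain ⟨a, α⟩ := p
    have h (i : Fin n) : 0 < n - (i : ℕ) := by omega
    ext i
    · simp [Nat.mod_eq_of_lt]
    · simp only [Finsupp.coe_equivFunOnFinite_symm, Fin.rev_rev]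
      rw [Nat.add_mul_div_left _ _ (h _), Nat.div_eq_of_lt (a i.rev).2, zero_add]
  right_inv β := by
    ext i
    simp only [Finsupp.coe_equivFunOnFinite_symm, Fin.rev_rev]
    exact Nat.mod_add_div _ _

lemma degree_staircaseEquiv {n : ℕ} (p : StaircaseExp n × (Fin n →₀ ℕ)) :
    (staircaseEquiv n p).degree = staircaseDegree p := by
  rw [Finsupp.degree_eq_sum]
  simp only [staircaseEquiv, Equiv.coe_fn_mk, Finsupp.coe_equivFunOnFinite_symm,
    Finset.sum_add_distrib, staircaseDegree]
  congr 1
  rw [← Equiv.sum_comp Fin.revPerm]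
  refine Finset.sum_congr rfl fun k _ => ?_
  simp only [Fin.revPerm_apply, Fin.rev_rev, Fin.val_rev]
  congr 1
  omega

section EvalZel

open scoped IsMulCommutative

lemma isMulCommutative_W0 (n : ℕ) : IsMulCommutative (W0 n) := by
  refine Algebra.isMulCommutative_adjoin ℂ ?_
  rintro _ ⟨i, rfl⟩ _ ⟨j, rfl⟩
  exact commute_zel i.2 j.2

/-- The evaluation of polynomials at the commuting elements `z₀, …, z_{n−1}` of `Cl(Q)`. -/
def evalZel (n : ℕ) : MvPolynomial (Fin n) ℂ →ₐ[ℂ] CliffordAlgebra (Qform n) :=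
  have := isMulCommutative_W0 n
  (W0 n).val.comp (aeval fun k : Fin n =>
    (⟨zel n k, Algebra.subset_adjoin ⟨k, rfl⟩⟩ : W0 n))

lemma evalZel_X {n : ℕ} (k : Fin n) : evalZel n (X k) = zel n k := by
  simp [evalZel]

lemma evalZel_mem_W0 {n : ℕ} (f : MvPolynomial (Fin n) ℂ) : evalZel n f ∈ W0 n := by
  simp [evalZel]

end EvalZel

lemma exists_evalZel_eq {n : ℕ} {y : CliffordAlgebra (Qform n)} (hy : y ∈ W0 n) :
    ∃ f, evalZel n f = y := by
  have h : W0 n ≤ (evalZel n).range := by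
    refine Algebra.adjoin_le ?_
    rintro _ ⟨k, rfl⟩
    exact ⟨X k, evalZel_X k⟩
  exact h hy

lemma mul_sub_algebraMap_mul_mem_wordSpan {n d e : ℕ} {y y' : CliffordAlgebra (Qform n)}
    {f g : MvPolynomial (Fin n) ℂ} (hf : f.IsHomogeneous d) (hg : g.IsHomogeneous e)
    (hy : y - algebraMap _ _ f ∈ wordSpan n (2 * d))
    (hy' : y' - algebraMap _ _ g ∈ wordSpan n (2 * e)) :
    y * y' - algebraMap _ _ (f * g) ∈ wordSpan n (2 * (d + e)) := by
  have hy'' : y' ∈ wordSpan n (2 * e + 1) := by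
    rw [← sub_add_cancel y' (algebraMap _ _ g)]
    exact add_mem (wordSpan_mono n (by omega) hy') (algebraMap_mem_wordSpan hg)
  have h : y * y' - algebraMap _ _ (f * g) =
      (y - algebraMap _ _ f) * y' + algebraMap _ _ f * (y' - algebraMap _ _ g) := by
    rw [map_mul]
    noncomm_ring
  rw [h]
  exact add_mem (mul_mem_wordSpan_of_forall (by omega) hy hy'')
    (mul_mem_wordSpan_of_forall (by omega) (algebraMap_mem_wordSpan hf) hy')

lemma evalZel_monomial_sub_mem_wordSpan {n : ℕ} (α : Fin n →₀ ℕ) :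
    evalZel n (monomial α 1) - algebraMap _ _ (leadMonomial α) ∈
      wordSpan n (2 * ∑ k : Fin n, (k + 1) * α k) := by
  induction α using Finsupp.induction_linear with
  | zero => simp [leadMonomial]
  | add α β hα hβ =>
    have h := mul_sub_algebraMap_mul_mem_wordSpan (isHomogeneous_leadMonomial α)
      (isHomogeneous_leadMonomial β) hα hβ
    rw [← map_mul, monomial_mul, one_mul] at h
    simpa [leadMonomial, pow_add, Finset.prod_mul_distrib, mul_add, Finset.sum_add_distrib] using h
  | single k m =>
    have h : evalZel n (X k ^ m) - algebraMap _ _ (leadZel n k ^ m) ∈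
        wordSpan n (2 * ((k + 1) * m)) := by
      induction m with
      | zero => simp
      | succ m ih =>
        have := mul_sub_algebraMap_mul_mem_wordSpan ((isHomogeneous_leadZel n k).pow m)
          (isHomogeneous_leadZel n k) ih (zel_sub_mem_wordSpan n k)
        rwa [← evalZel_X, ← map_mul, ← pow_succ, ← pow_succ] at this
    rw [X_pow_eq_monomial] at h
    have h1 : leadMonomial (Finsupp.single k m) = leadZel n k ^ m := by
      rw [leadMonomial, Finset.prod_eq_single k] <;> simp +contextual [eq_comm]
    have h2 : ∑ i : Fin n, ((i : ℕ) + 1) * Finsupp.single k m i = (k + 1) * m := by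
      rw [Finset.sum_eq_single k] <;> simp +contextual [eq_comm]
    rwa [h1, h2]

/-- The products `x^a ξ_S z^α`, which form a `ℂ`-basis of `Cl(Q)` when `a` ranges over staircase
exponents. -/
def cliffVec {n : ℕ} (p : (StaircaseExp n × (Fin n →₀ ℕ)) × Finset (Fin n)) :
    CliffordAlgebra (Qform n) :=
  (staircaseMonomial p.1.1 • xiProd p.2) * evalZel n (monomial p.1.2 1)

lemma wordSpan_le_span_cliffVec (n d : ℕ) : wordSpan n d ≤
    Submodule.span ℂ (cliffVec '' {p | p.2.card + 2 * staircaseDegree p.1 < d}) := by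
  induction d with
  | zero =>
    refine (wordSpan_le n 0).trans ?_
    simp
  | succ d ih =>
    refine (wordSpan_le n (d + 1)).trans (Submodule.span_le.2 ?_)
    rintro _ ⟨⟨m, s⟩, hd, rfl⟩
    replace hd : s.card + 2 * m.degree < d + 1 := hd
    rw [monomialBasis_apply]
    have hm := mem_span_staircase_of_isHomogeneous
      (isHomogeneous_monomial (d := m) (n := m.degree) (1 : ℂ) rfl)
    have hlin := Submodule.mem_map_of_mem
      (f := (LinearMap.toSpanSingleton (MvPolynomial (Fin n) ℂ) _ (xiProd s)).restrictScalars ℂ) hm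
    rw [Submodule.map_span] at hlin
    refine Submodule.span_le.2 ?_ hlin
    rintro _ ⟨_, ⟨⟨a, α⟩, hp, rfl⟩, rfl⟩
    replace hp : staircaseDegree (a, α) = m.degree := hp
    have heq : (staircaseMonomial a * leadMonomial α) • xiProd s = cliffVec ((a, α), s) -
        (algebraMap _ _ (staircaseMonomial a) * xiProd s) * (evalZel n (monomial α 1) -
          algebraMap _ _ (leadMonomial α)) := by
      rw [cliffVec, mul_sub, Algebra.smul_def, Algebra.smul_def, map_mul, sub_sub_cancel,
        mul_assoc, mul_assoc, Algebra.commutes (leadMonomial α)]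
    change (staircaseMonomial a * leadMonomial α) • xiProd s ∈ _
    rw [heq]
    refine sub_mem (Submodule.subset_span ⟨((a, α), s), ?_, rfl⟩) ?_
    · change s.card + 2 * staircaseDegree (a, α) < d + 1
      omega
    · refine Submodule.span_mono (Set.image_mono ?_) (ih ?_)
      · exact fun p hp => Nat.lt_succ_of_lt hp
      · have h1 : algebraMap _ _ (staircaseMonomial a) * xiProd s ∈
            wordSpan n (2 * (∑ i, (a i : ℕ)) + s.card + 1) :=
          mul_mem_wordSpan_of_forall (by omega)
            (algebraMap_mem_wordSpan (isHomogeneous_staircaseMonomial a)) (xiProd_mem_wordSpan s)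
        have h2 : staircaseDegree (a, α) = ∑ i, (a i : ℕ) + ∑ k : Fin n, (k + 1) * α k := rfl
        exact mul_mem_wordSpan_of_forall (by omega) h1 (evalZel_monomial_sub_mem_wordSpan α)

lemma linearIndependent_and_span_cliffVec (n : ℕ) :
    LinearIndependent ℂ (cliffVec (n := n)) ∧
      ⊤ ≤ Submodule.span ℂ (Set.range (cliffVec (n := n))) := by
  refine linearIndependent_and_span_of_degree (monomialBasis n) cliffVec
    ((staircaseEquiv n).prodCongr (.refl _)) (fun p => p.2.card + 2 * p.1.degree) (fun d => ?_)
    fun p => ?_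
  · refine ((Finsupp.finite_of_degree_lt d).prod Set.finite_univ).subset fun p hp => ⟨?_, trivial⟩
    have hp' : p.2.card + 2 * p.1.degree < d := hp
    change p.1.degree < d
    omega
  · simpa [degree_staircaseEquiv] using
      wordSpan_le_span_cliffVec n _ (monomialBasis_mem_wordSpan p)

/-- The basis of `Cl(Q)` over `ℂ` given by `cliffVec`. -/
def cliffVecBasis (n : ℕ) : Module.Basis ((StaircaseExp n × (Fin n →₀ ℕ)) × Finset (Fin n)) ℂ
    (CliffordAlgebra (Qform n)) :=
  .mk (linearIndependent_and_span_cliffVec n).1 (linearIndependent_and_span_cliffVec n).2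

/-- The linear map `(g_j)_j ↦ ∑_j b_j g_j(z)`, where the `b_j` are the products `x^a ξ_S`. -/
def sumMulEvalZel (n : ℕ) : (StaircaseExp n × Finset (Fin n) → MvPolynomial (Fin n) ℂ) →ₗ[ℂ]
    CliffordAlgebra (Qform n) :=
  ∑ j, LinearMap.mulLeft ℂ (staircaseMonomial j.1 • xiProd j.2) ∘ₗ (evalZel n).toLinearMap ∘ₗ
    LinearMap.proj j

lemma sumMulEvalZel_apply {n : ℕ} (g : StaircaseExp n × Finset (Fin n) → MvPolynomial (Fin n) ℂ) :
    sumMulEvalZel n g = ∑ j, (staircaseMonomial j.1 • xiProd j.2) * evalZel n (g j) := by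
  simp [sumMulEvalZel]

lemma bijective_sumMulEvalZel (n : ℕ) : Function.Bijective (sumMulEvalZel n) := by
  let e : (Σ _ : StaircaseExp n × Finset (Fin n), Fin n →₀ ℕ) ≃
      (StaircaseExp n × (Fin n →₀ ℕ)) × Finset (Fin n) :=
    { toFun := fun q => ((q.1.1, q.2), q.1.2)
      invFun := fun p => ⟨(p.1.1, p.2), p.1.2⟩ }
  let B := Pi.basis fun _ : StaircaseExp n × Finset (Fin n) => basisMonomials (Fin n) ℂ
  have h : sumMulEvalZel n = (B.equiv (cliffVecBasis n) e).toLinearMap := by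
    refine B.ext fun q => ?_
    obtain ⟨j, α⟩ := q
    rw [LinearEquiv.coe_coe, Module.Basis.equiv_apply, sumMulEvalZel_apply,
      Finset.sum_eq_single j]
    · simp [B, e, cliffVecBasis, cliffVec]
    · intro i _ hi
      simp [B, Pi.basis_apply, hi]
    · simp
  rw [h]
  exact (B.equiv (cliffVecBasis n) e).bijective

lemma card_staircaseExp_prod (n : ℕ) :
    Fintype.card (StaircaseExp n × Finset (Fin n)) = 2 ^ n * n.factorial := by
  rw [Fintype.card_prod, Fintype.card_finset, Fintype.card_fin, mul_comm,
    Fintype.card_pi, ← Nat.descFactorial_self, Nat.descFactorial_eq_prod_range,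
    Finset.prod_range]
  simp

theorem clifford_free_over_W0 (n : ℕ) (hn : 0 < n) :
    ∃ b : Fin (2 ^ n * n.factorial) → CliffordAlgebra (Qform n),
      ∀ a : CliffordAlgebra (Qform n),
        ∃! y : Fin (2 ^ n * n.factorial) → W0 n,
          a = ∑ j : Fin (2 ^ n * n.factorial), b j * (y j : CliffordAlgebra (Qform n)) := by
  let e := Fintype.equivFinOfCardEq (card_staircaseExp_prod n)
  refine ⟨fun j => staircaseMonomial (e.symm j).1 • xiProd (e.symm j).2, fun a => ?_⟩
  obtain ⟨g, hg⟩ := (bijective_sumMulEvalZel n).2 a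
  refine ⟨fun j => ⟨evalZel n (g (e.symm j)), evalZel_mem_W0 _⟩, ?_, fun y hy => ?_⟩
  · rw [← hg, sumMulEvalZel_apply, ← e.symm.sum_comp]
  · choose f hf using fun j => exists_evalZel_eq (y j).2
    have hfg : sumMulEvalZel n (f ∘ e) = sumMulEvalZel n g := by
      rw [hg, hy, sumMulEvalZel_apply, ← e.symm.sum_comp]
      simp [hf]
    ext j
    rw [← hf, ← (bijective_sumMulEvalZel n).1 hfg]
    simp
end
end
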